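/- arXiv:1008.4811 — 3 statements merged into one kernel-verified Lean document; each statement's English description precedes it below -/
import Mathlib

section
/- Let H be a separable Hilbert space and k ∈ ℕ. The family 𝒞 of all subspaces of H of dimension at most k satisfies MSAP: for every finite set F ⊆ H there exists a subspace V° with dim V° ≤ k such that Σ_{f∈F} dist(f,V°)² = inf{Σ_{f∈F} dist(f,V)² : V a subspace of H with dim V ≤ k}. -/
open Metric

/-- In a separable Hilbert space `H`, the family of all subspaces of
dimension at most `k` satisfies MSAP: for every finite set `F ⊆ H` there is a subspace of
dimension at most `k` minimizing `Σ_{f ∈ F} dist(f, V)²`. -/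
theorem msap_dimension_le_k
    {H : Type*} [NormedAddCommGroup H] [InnerProductSpace ℂ H] [CompleteSpace H]
    [TopologicalSpace.SeparableSpace H] (k : ℕ) :
    ∀ F : Finset H, ∃ V : Submodule ℂ H, Module.rank ℂ V ≤ k ∧
      (∑ f ∈ F, infDist f (V : Set H) ^ 2) =
        ⨅ W : {W : Submodule ℂ H // Module.rank ℂ W ≤ k},
          ∑ f ∈ F, infDist f ((W : Submodule ℂ H) : Set H) ^ 2 := by
  intro F
  let S : Submodule ℂ H := Submodule.span ℂ (F : Set H)
  have : FiniteDimensional ℂ S := FiniteDimensional.span_finset ℂ F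
  have : ProperSpace (S →L[ℂ] S) := FiniteDimensional.proper ℂ (S →L[ℂ] S)
  let P : H →L[ℂ] S := S.orthogonalProjectionOnto
  have hPS : ∀ f ∈ F, ((P f : S) : H) = f := fun f hf =>
    Submodule.starProjection_eq_self_iff.2 (Submodule.subset_span hf)
  let T : Set (S →L[ℂ] S) :=
    closedBall 0 1 ∩ {A | ((k + 1 : ℕ) : Cardinal) ≤ (A : S →ₗ[ℂ] S).rank}ᶜ
  have hT : IsCompact T :=
    (isCompact_closedBall 0 1).inter_right
      (isOpen_setOfPred_nat_le_rank (k + 1)).isClosed_compl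
  have hmemT : ∀ A : S →L[ℂ] S, A ∈ T ↔ ‖A‖ ≤ 1 ∧ (A : S →ₗ[ℂ] S).rank ≤ k := by
    intro A
    have : (A : S →ₗ[ℂ] S).rank < ((k + 1 : ℕ) : Cardinal) ↔ (A : S →ₗ[ℂ] S).rank ≤ k := by
      rw [Nat.cast_add, Nat.cast_one, ← Order.succ_le_succ_iff, Cardinal.succ_natCast,
        Order.succ_le_iff]
    simp only [T, Set.mem_inter_iff, mem_closedBall, Set.mem_compl_iff,
      Set.mem_ofPred_eq, not_le, this]
    rw [show dist A 0 = ‖A‖ from dist_zero_right A]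
  let Φ : (S →L[ℂ] S) → ℝ := fun A => ∑ f ∈ F, ‖f - ((A (P f) : S) : H)‖ ^ 2
  have hΦ : Continuous Φ := by fun_prop
  have hne : T.Nonempty := ⟨0, (hmemT 0).2 ⟨(norm_zero (E := S →L[ℂ] S)).trans_le zero_le_one, by
    rw [ContinuousLinearMap.toLinearMap_zero, LinearMap.rank_zero]; exact zero_le⟩⟩
  obtain ⟨A, hA, hmin⟩ := hT.exists_isMinOn hne hΦ.continuousOn
  let V : Submodule ℂ H := (LinearMap.range (A : S →ₗ[ℂ] S)).map S.subtype
  have hV : Module.rank ℂ V ≤ k := by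
    refine le_trans (rank_map_le _ _) ((hmemT A).1 hA).2
  have hVΦ : ∑ f ∈ F, infDist f (V : Set H) ^ 2 ≤ Φ A := by
    refine Finset.sum_le_sum fun f _ => ?_
    refine pow_le_pow_left₀ infDist_nonneg ?_ 2
    rw [← dist_eq_norm]
    exact infDist_le_dist_of_mem ⟨A (P f), ⟨P f, rfl⟩, rfl⟩
  have hle : ∀ W : Submodule ℂ H, Module.rank ℂ W ≤ k →
      Φ A ≤ ∑ f ∈ F, infDist f (W : Set H) ^ 2 := by
    intro W hW
    have : FiniteDimensional ℂ W :=
      Module.rank_lt_aleph0_iff.1 (hW.trans_lt (Cardinal.natCast_lt_aleph0))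
    let B : S →L[ℂ] S := (P ∘L W.subtypeL) ∘L (W.orthogonalProjectionOnto ∘L S.subtypeL)
    have hB : B ∈ T := by
      refine (hmemT B).2 ⟨?_, ?_⟩
      · refine ContinuousLinearMap.opNorm_le_bound _ zero_le_one fun x => ?_
        rw [one_mul]
        exact (S.norm_orthogonalProjectionOnto_apply_le _).trans
          (W.norm_orthogonalProjectionOnto_apply_le (x : H))
      · refine (LinearMap.rank_comp_le_left
          (W.orthogonalProjectionOnto ∘L S.subtypeL : S →L[ℂ] W).toLinearMap
          (P ∘L W.subtypeL : W →L[ℂ] S).toLinearMap).trans ?_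
        exact (LinearMap.rank_le_domain _).trans hW
    refine (hmin hB).trans (Finset.sum_le_sum fun f hf => ?_)
    refine pow_le_pow_left₀ (norm_nonneg _) ?_ 2
    have h1 : f - ((B (P f) : S) : H) = P (f - W.starProjection f) := by
      have : B (P f) = P (W.starProjection f) := by
        change P (W.starProjection ((P f : S) : H)) = _
        rw [hPS f hf]
      rw [this, map_sub, Submodule.coe_sub, hPS f hf]
    rw [h1]
    refine (S.norm_orthogonalProjectionOnto_apply_le _).trans ?_
    rw [le_infDist ⟨0, W.zero_mem⟩]
    intro y hy
    rw [Submodule.starProjection_minimal, dist_eq_norm]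
    exact ciInf_le ⟨0, by rintro _ ⟨x, rfl⟩; exact norm_nonneg _⟩ (⟨y, hy⟩ : W)
  refine ⟨V, hV, le_antisymm ?_ ?_⟩
  · have : Nonempty {W : Submodule ℂ H // Module.rank ℂ W ≤ k} := ⟨⟨V, hV⟩⟩
    exact le_ciInf fun W => hVΦ.trans (hle W.1 W.2)
  · exact ciInf_le (f := fun W : {W : Submodule ℂ H // Module.rank ℂ W ≤ k} =>
      ∑ f ∈ F, infDist f ((W : Submodule ℂ H) : Set H) ^ 2)
      ⟨0, by rintro _ ⟨x, rfl⟩; positivity⟩ ⟨V, hV⟩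
end

section
/- Let k ∈ ℕ and let 𝒞_k be the family of all shift-invariant subspaces of L²(ℝ^d) of length at most k, i.e. all closed subspaces W for which there exist φ₁,…,φ_k ∈ L²(ℝ^d) with W equal to the closed linear span of {φᵢ(· − j) : 1 ≤ i ≤ k, j ∈ ℤ^d}. Then 𝒞_k satisfies MSAP: for every finite set F ⊆ L²(ℝ^d) there exists W° ∈ 𝒞_k with Σ_{f∈F} dist(f,W°)² = inf_{W∈𝒞_k} Σ_{f∈F} dist(f,W)². -/
open MeasureTheory Metric

noncomputable section

variable {d : ℕ}

/-- Translation by `j ∈ ℤ^d` on `L²(ℝ^d)`: `f ↦ f(· - j)`. -/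
noncomputable def translateZ (j : Fin d → ℤ) :
    Lp ℂ 2 (volume : Measure (Fin d → ℝ)) → Lp ℂ 2 (volume : Measure (Fin d → ℝ)) :=
  Lp.compMeasurePreserving (fun x => x - fun i => (j i : ℝ))
    (measurePreserving_sub_right volume _)

/-- The family of shift-invariant subspaces of `L²(ℝ^d)` of length at most `k`: closed
subspaces which are the closed linear span of the integer translates of at most `k`
functions. -/
def shiftInvariantLengthLE (d k : ℕ) :
    Set (Submodule ℂ (Lp ℂ 2 (volume : Measure (Fin d → ℝ)))) :=
  {W | ∃ φ : Fin k → Lp ℂ 2 (volume : Measure (Fin d → ℝ)),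
    W = (Submodule.span ℂ
      {x | ∃ (i : Fin k) (j : Fin d → ℤ), x = translateZ j (φ i)}).topologicalClosure}

section Helpers
set_option linter.all false
open Filter Topology
open scoped ComplexConjugate

theorem cInf_attained {K : Type*} [TopologicalSpace K] [CompactSpace K] [Nonempty K]
    [TopologicalSpace.SeparableSpace K] (g : K → ℝ) (hg : Continuous g) :
    ∃ x, (⨅ q : ℕ, g (TopologicalSpace.denseSeq K q)) = g x ∧ ∀ z, g x ≤ g z := by
  obtain ⟨x, -, hx⟩ := isCompact_univ.exists_isMinOn Set.univ_nonempty hg.continuousOn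
  have hx' : ∀ z, g x ≤ g z := fun z => hx (Set.mem_univ z)
  refine ⟨x, le_antisymm ?_ (le_ciInf fun q => hx' _), hx'⟩
  have hb : BddBelow (Set.range fun q : ℕ => g (TopologicalSpace.denseSeq K q)) :=
    ⟨g x, by rintro _ ⟨q, rfl⟩; exact hx' _⟩
  have hcl : IsClosed {z | (⨅ q : ℕ, g (TopologicalSpace.denseSeq K q)) ≤ g z} :=
    isClosed_le continuous_const hg
  have : Set.univ ⊆ {z | (⨅ q : ℕ, g (TopologicalSpace.denseSeq K q)) ≤ g z} := by
    rw [← (TopologicalSpace.denseRange_denseSeq K).closure_eq]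
    refine hcl.closure_subset_iff.2 ?_
    rintro _ ⟨q, rfl⟩
    exact ciInf_le hb q
  exact this (Set.mem_univ x)

def cGlue (n : ℕ) (s x : ℕ → Bool) : ℕ → Bool := fun i => if i < n then s i else x i

theorem continuous_cGlue (n : ℕ) : Continuous (fun p : (ℕ → Bool) × (ℕ → Bool) => cGlue n p.1 p.2) := by
  refine continuous_pi fun i => ?_
  unfold cGlue
  by_cases h : i < n <;> simp only [h, if_true, if_false] <;> fun_prop

section
variable {Ω : Type*} [MeasurableSpace Ω] (h : Ω → (ℕ → Bool) → ℝ)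

def cMin (n : ℕ) (p : Ω × (ℕ → Bool)) : Prop := ∃ x, ∀ z, h p.1 (cGlue n p.2 x) ≤ h p.1 z

theorem measurableSet_cMin (hm : ∀ x, Measurable fun ω => h ω x) (hc : ∀ ω, Continuous (h ω)) (n : ℕ) :
    MeasurableSet {p | cMin h n p} := by
  have hj : Measurable (fun p : Ω × (ℕ → Bool) => h p.1 p.2) := by
    have := measurable_uncurry_of_continuous_of_measurable (u := fun x ω => h ω x) hc hm
    exact this.comp measurable_swap
  have e : {p | cMin h n p} = {p : Ω × (ℕ → Bool) |
      (⨅ q : ℕ, h p.1 (cGlue n p.2 (TopologicalSpace.denseSeq (ℕ → Bool) q))) ≤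
      ⨅ q : ℕ, h p.1 (TopologicalSpace.denseSeq (ℕ → Bool) q)} := by
    ext ⟨ω, s⟩
    obtain ⟨x, hx, hx'⟩ := cInf_attained (fun x => h ω (cGlue n s x))
      ((hc ω).comp ((continuous_cGlue n).comp (by fun_prop : Continuous fun x => (s, x))))
    obtain ⟨y, hy, hy'⟩ := cInf_attained (h ω) (hc ω)
    simp only [Set.mem_ofPred_eq, cMin]
    rw [hx, hy]
    constructor
    · rintro ⟨w, hw⟩; exact (hx' w).trans (hw y)
    · intro hxy; exact ⟨x, fun z => hxy.trans (hy' z)⟩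
  rw [e]
  refine measurableSet_le (Measurable.iInf fun q => ?_) (Measurable.iInf fun q => ?_)
  · have : Continuous fun s => cGlue n s (TopologicalSpace.denseSeq (ℕ → Bool) q) :=
      (continuous_cGlue n).comp (by fun_prop : Continuous fun s => (s, TopologicalSpace.denseSeq (ℕ → Bool) q))
    exact hj.comp (measurable_fst.prodMk (this.measurable.comp measurable_snd))
  · exact (hm _).comp measurable_fst

open Classical in
noncomputable def cSeq : ℕ → Ω → (ℕ → Bool)
  | 0, _ => fun _ => false
  | n+1, ω => if cMin h (n+1) (ω, Function.update (cSeq n ω) n false) then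
      Function.update (cSeq n ω) n false else Function.update (cSeq n ω) n true

theorem measurable_cSeq (hm : ∀ x, Measurable fun ω => h ω x) (hc : ∀ ω, Continuous (h ω)) (n : ℕ) :
    Measurable (cSeq h n) := by
  induction n with
  | zero => exact measurable_const
  | succ n ih =>
    have hu : ∀ b : Bool, Measurable fun ω => Function.update (cSeq h n ω) n b := fun b => by
      have : Continuous fun s : ℕ → Bool => Function.update s n b := by fun_prop
      exact this.measurable.comp ih
    refine Measurable.ite ?_ (hu _) (hu _)
    exact (measurable_id.prodMk (hu false)) (measurableSet_cMin h hm hc (n+1))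

theorem cMin_cSeq (hc : ∀ ω, Continuous (h ω)) (n : ℕ) (ω : Ω) : cMin h n (ω, cSeq h n ω) := by
  induction n with
  | zero =>
    obtain ⟨y, hy, hy'⟩ := cInf_attained (h ω) (hc ω)
    have e : cGlue 0 (cSeq h 0 ω) y = y := by ext i; simp [cGlue]
    exact ⟨y, by simpa only [e] using hy'⟩
  | succ n ih =>
    by_cases hcm : cMin h (n+1) (ω, Function.update (cSeq h n ω) n false)
    · rw [cSeq, if_pos hcm]; exact hcm
    · rw [cSeq, if_neg hcm]
      obtain ⟨x, hx⟩ := ih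
      have key : ∀ b, x n = b → cGlue (n+1) (Function.update (cSeq h n ω) n b) x = cGlue n (cSeq h n ω) x := by
        intro b hb
        ext i
        simp only [cGlue, Function.update_apply]
        rcases lt_trichotomy i n with h1 | h1 | h1
        · simp [h1, h1.ne, Nat.lt_succ_of_lt h1]
        · subst h1; simp [hb]
        · simp [show ¬ i < n by omega, show ¬ i < n + 1 by omega]
      have hxn : x n = true := by
        by_contra hne
        exact hcm ⟨x, by simpa [key false (by simpa using hne)] using hx⟩
      exact ⟨x, by simpa [key true hxn] using hx⟩

theorem cSeq_stable (n i : ℕ) (hi : i < n) (ω : Ω) : cSeq h n ω i = cSeq h (i+1) ω i := by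
  induction n with
  | zero => omega
  | succ n ih =>
    rcases Nat.lt_succ_iff_lt_or_eq.1 hi with h1 | h1
    · rw [← ih h1, cSeq]
      split_ifs <;> simp [h1.ne]
    · subst h1; rfl

theorem cantor_selection (hm : ∀ x, Measurable fun ω => h ω x) (hc : ∀ ω, Continuous (h ω)) :
    ∃ u : Ω → (ℕ → Bool), Measurable u ∧ ∀ ω z, h ω (u ω) ≤ h ω z := by
  refine ⟨fun ω n => cSeq h (n+1) ω n, ?_, ?_⟩
  · exact measurable_pi_iff.2 fun n => (measurable_pi_apply n).comp (measurable_cSeq h hm hc (n+1))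
  · intro ω z
    choose x hx using fun n => cMin_cSeq h hc n ω
    have ht : Tendsto (fun n => cGlue n (cSeq h n ω) (x n)) atTop (𝓝 (fun n => cSeq h (n+1) ω n)) := by
      refine tendsto_pi_nhds.2 fun i => ?_
      refine tendsto_const_nhds.congr' ?_
      filter_upwards [eventually_gt_atTop i] with n hn
      simp [cGlue, hn, cSeq_stable h n i hn ω]
    exact le_of_tendsto (((hc ω).tendsto _).comp ht) (Eventually.of_forall fun n => hx n z)
end

theorem measurable_argmin {Ω K : Type*} [MeasurableSpace Ω] [MetricSpace K] [CompactSpace K]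
    [Nonempty K] [MeasurableSpace K] [BorelSpace K] (h : Ω → K → ℝ)
    (hm : ∀ x, Measurable fun ω => h ω x) (hc : ∀ ω, Continuous (h ω)) :
    ∃ u : Ω → K, Measurable u ∧ ∀ ω z, h ω (u ω) ≤ h ω z := by
  obtain ⟨π, hπ, hs⟩ := exists_nat_bool_continuous_surjective_of_compact K
  obtain ⟨u, hu, hu'⟩ := cantor_selection (fun ω x => h ω (π x)) (fun x => hm _)
    (fun ω => (hc ω).comp hπ)
  refine ⟨fun ω => π (u ω), hπ.measurable.comp hu, fun ω z => ?_⟩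
  obtain ⟨x, rfl⟩ := hs z
  exact hu' ω x


theorem bessel_vec {E ι κ : Type*} [Fintype ι] [Fintype κ] [DecidableEq κ] [NormedAddCommGroup E] [InnerProductSpace ℂ E]
    (d : ι → E) (b : κ → ι → ℂ)
    (hb : ∀ l l', ∑ i, conj (b l i) * b l' i = if l = l' then 1 else 0) :
    ∑ i, ‖d i - ∑ l, conj (b l i) • ∑ j, b l j • d j‖ ^ 2 ≤ ∑ i, ‖d i‖ ^ 2 := by
  set q : κ → E := fun l => ∑ j, b l j • d j with hq
  have h1 : ∑ i, inner ℂ (d i - ∑ l, conj (b l i) • q l) (d i - ∑ l, conj (b l i) • q l)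
      = ∑ i, inner ℂ (d i) (d i) - ∑ l, inner ℂ (q l) (q l) := by
    have hA : ∑ i, inner ℂ (d i) (∑ l, conj (b l i) • q l) = ∑ l, inner ℂ (q l) (q l) := by
      simp only [inner_sum, inner_smul_right]
      rw [Finset.sum_comm]
      refine Finset.sum_congr rfl fun l _ => ?_
      have : inner ℂ (q l) (q l) = inner ℂ (∑ j, b l j • d j) (q l) := rfl
      rw [this]
      simp only [sum_inner, inner_smul_left]
    have hB : ∑ i, inner ℂ (∑ l, conj (b l i) • q l) (d i) = ∑ l, inner ℂ (q l) (q l) := by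
      have := congrArg (starRingEnd ℂ) hA
      simpa only [map_sum, inner_conj_symm] using this
    have hC : ∑ i, inner ℂ (∑ l, conj (b l i) • q l) (∑ l, conj (b l i) • q l)
        = ∑ l, inner ℂ (q l) (q l) := by
      simp only [inner_sum, sum_inner, inner_smul_right, inner_smul_left, RingHomCompTriple.comp_apply,
        RingHom.id_apply, Finset.mul_sum]
      rw [Finset.sum_comm]
      refine Finset.sum_congr rfl fun l _ => ?_
      rw [Finset.sum_comm]
      have : ∀ l', ∑ i, conj (b l i) * (b l' i * inner ℂ (q l') (q l)) =
          (if l = l' then 1 else 0) * inner ℂ (q l') (q l) := fun l' => by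
        rw [← hb, Finset.sum_mul]; exact Finset.sum_congr rfl fun i _ => by ring
      simp [this]
    simp only [inner_sub_left, inner_sub_right, Finset.sum_sub_distrib]
    rw [hA, hB, hC]; ring
  have h2 := congrArg Complex.re h1
  simp only [inner_self_eq_norm_sq_to_K, Complex.sub_re, Complex.re_sum] at h2
  norm_cast at h2
  have : ∑ i, ‖d i - ∑ l, conj (b l i) • q l‖ ^ 2 = ∑ i, ‖d i‖ ^ 2 - ∑ l, ‖q l‖ ^ 2 := by
    simpa [← Complex.ofReal_pow] using h2
  rw [this]
  have : 0 ≤ ∑ l, ‖q l‖ ^ 2 := by positivity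
  linarith

theorem rank_approx {E ι : Type*} [Fintype ι] [NormedAddCommGroup E] [InnerProductSpace ℂ E]
    (k : ℕ) (f p : ι → E) (ψ : Fin k → E) (hp : ∀ i, p i ∈ Submodule.span ℂ (Set.range ψ)) :
    ∃ B ∈ closedBall (0 : Fin k → ι → ℂ) 1,
      ∑ i, ‖f i - ∑ l, conj (B l i) • ∑ j, B l j • f j‖ ^ 2 ≤ ∑ i, ‖f i - p i‖ ^ 2 := by
  classical
  let P : EuclideanSpace ℂ ι →ₗ[ℂ] E :=
    (Fintype.linearCombination ℂ p).comp (WithLp.linearEquiv 2 ℂ (ι → ℂ)).toLinearMap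
  have hPapply : ∀ c, P c = ∑ j, c j • p j := fun c => rfl
  have hrank : Module.finrank ℂ (LinearMap.range P) ≤ k := by
    have hle : LinearMap.range P ≤ Submodule.span ℂ (Set.range ψ) := by
      rintro _ ⟨c, rfl⟩
      rw [hPapply]
      exact Submodule.sum_mem _ fun j _ => Submodule.smul_mem _ _ (hp j)
    have : FiniteDimensional ℂ (Submodule.span ℂ (Set.range ψ)) :=
      FiniteDimensional.span_of_finite ℂ (Set.finite_range ψ)
    exact (Submodule.finrank_mono hle).trans ((finrank_range_le_card (R := ℂ) ψ).trans (by simp))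
  set N := LinearMap.ker P
  have hr : Module.finrank ℂ Nᗮ ≤ k := by
    have h1 := LinearMap.finrank_range_add_finrank_ker P
    have h2 := Submodule.finrank_add_finrank_orthogonal N
    have : Module.finrank ℂ Nᗮ = Module.finrank ℂ (LinearMap.range P) := by
      change _ + Module.finrank ℂ N = _ at h1
      omega
    omega
  set r := Module.finrank ℂ Nᗮ
  let b := stdOrthonormalBasis ℂ Nᗮ
  let β : Fin r → ι → ℂ := fun l i => (b l : EuclideanSpace ℂ ι) i
  have hβ : ∀ l l', ∑ i, conj (β l i) * β l' i = if l = l' then 1 else 0 := by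
    intro l l'
    have := orthonormal_iff_ite.1 b.orthonormal l l'
    rw [← this, Submodule.coe_inner, PiLp.inner_apply]
    refine Finset.sum_congr rfl fun i _ => ?_
    simp [β, mul_comm]
  have hproj : ∀ i, p i = ∑ l, conj (β l i) • ∑ j, β l j • p j := by
    intro i
    have hmem : EuclideanSpace.single i (1:ℂ) - Nᗮ.starProjection (EuclideanSpace.single i (1:ℂ)) ∈ N := by
      have := Submodule.sub_starProjection_mem_orthogonal (K := Nᗮ) (EuclideanSpace.single i (1:ℂ))
      rwa [Submodule.orthogonal_orthogonal] at this
    have h0 : P (EuclideanSpace.single i (1:ℂ)) = P (Nᗮ.starProjection (EuclideanSpace.single i (1:ℂ))) := by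
      have := LinearMap.mem_ker.1 hmem
      rwa [map_sub, sub_eq_zero] at this
    have h1 : P (EuclideanSpace.single i (1:ℂ)) = p i := by
      rw [hPapply]; simp [Pi.single_apply]
    have h2 : Nᗮ.starProjection (EuclideanSpace.single i (1:ℂ)) =
        ∑ l, conj (β l i) • (b l : EuclideanSpace ℂ ι) := by
      rw [Submodule.starProjection_apply, ← b.sum_repr' (Nᗮ.orthogonalProjectionOnto _)]
      simp only [Submodule.coe_sum, Submodule.coe_smul]
      refine Finset.sum_congr rfl fun l _ => ?_
      congr 1
      rw [Submodule.inner_orthogonalProjectionOnto_eq_of_mem_left]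
      simp [β, EuclideanSpace.inner_single_right]
    rw [← h1, h0, h2, map_sum]
    refine Finset.sum_congr rfl fun l _ => ?_
    rw [map_smul, hPapply]
  have hB1 : ∀ l i, ‖β l i‖ ≤ 1 := by
    intro l i
    have := PiLp.norm_apply_le (b l : EuclideanSpace ℂ ι) i
    have h2 : ‖(b l : EuclideanSpace ℂ ι)‖ = 1 := b.orthonormal.1 l
    rw [h2] at this; exact this
  refine ⟨fun l i => if h : (l : ℕ) < r then β ⟨l, h⟩ i else 0, ?_, ?_⟩
  · rw [mem_closedBall_zero_iff, pi_norm_le_iff_of_nonneg zero_le_one]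
    intro l
    rw [pi_norm_le_iff_of_nonneg zero_le_one]
    intro i
    split_ifs
    · exact hB1 _ _
    · simp
  · have hsum : ∀ i, ∑ l : Fin k, conj (if h : (l : ℕ) < r then β ⟨l, h⟩ i else 0) •
        ∑ j, (if h : (l : ℕ) < r then β ⟨l, h⟩ j else 0) • f j =
        ∑ l, conj (β l i) • ∑ j, β l j • f j := by
      intro i
      symm
      refine Finset.sum_of_injOn (Fin.castLE hr) (Fin.castLE_injective hr).injOn (by simp) ?_ ?_
      · intro l _ hl
        have : ¬ (l : ℕ) < r := fun hlt => hl ⟨⟨l, hlt⟩, by simp, rfl⟩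
        simp [this]
      · intro l _; simp
    simp only [hsum]
    refine le_trans (le_of_eq ?_) (bessel_vec (fun i => f i - p i) β hβ)
    refine Finset.sum_congr rfl fun i _ => ?_
    congr 2
    conv_rhs => rw [hproj i]
    simp only [smul_sub, Finset.sum_sub_distrib]
    have := hproj
    abel_nf


noncomputable def torMeas (d : ℕ) : Measure (UnitAddTorus (Fin d)) :=
  Measure.pi (fun _ => AddCircle.haarAddCircle)

instance (d : ℕ) : IsProbabilityMeasure (torMeas d) := by unfold torMeas; infer_instance

theorem integral_mFourier (d : ℕ) (n : Fin d → ℤ) :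
    ∫ x, UnitAddTorus.mFourier n x ∂(torMeas d) = if n = 0 then 1 else 0 := by
  have h1 : ∀ m : ℤ, ∫ x : UnitAddCircle, fourier m x ∂AddCircle.haarAddCircle = if m = 0 then 1 else 0 := by
    intro m
    have := congrFun (fourierCoeff_fourier (T := 1) m) 0
    simp only [fourierCoeff, neg_zero, fourier_zero, one_smul, Pi.single_apply] at this
    rw [this]; simp [eq_comm]
  have : ∫ x, UnitAddTorus.mFourier n x ∂(torMeas d) =
      ∏ i, ∫ x : UnitAddCircle, fourier (n i) x ∂AddCircle.haarAddCircle := 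
    integral_fintype_prod_eq_prod (𝕜 := ℂ) (fun i (x : UnitAddCircle) => fourier (n i) x)
  rw [this]
  simp only [h1]
  split_ifs with h
  · subst h; simp
  · obtain ⟨i, hi⟩ := Function.ne_iff.1 h
    exact Finset.prod_eq_zero (Finset.mem_univ i) (by simpa using hi)

theorem norm_mFourier_apply {d : ℕ} (n : Fin d → ℤ) (x : UnitAddTorus (Fin d)) :
    ‖UnitAddTorus.mFourier n x‖ = 1 := by
  simp only [UnitAddTorus.mFourier, ContinuousMap.coe_mk, norm_prod, fourier_apply, Circle.norm_coe, Finset.prod_const_one]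

theorem tor_uniq (d : ℕ) (F : UnitAddTorus (Fin d) → ℂ) (hF : Integrable F (torMeas d))
    (h : ∀ n, ∫ x, UnitAddTorus.mFourier n x * F x ∂(torMeas d) = 0) : F =ᵐ[torMeas d] 0 := by
  have hint : ∀ g : C(UnitAddTorus (Fin d), ℂ), Integrable (fun x => g x * F x) (torMeas d) := fun g =>
    hF.bdd_mul (c := ‖g‖) g.continuous.aestronglyMeasurable (Eventually.of_forall g.norm_coe_le_norm)
  let L : C(UnitAddTorus (Fin d), ℂ) →L[ℂ] ℂ := LinearMap.mkContinuous
    { toFun := fun g => ∫ x, g x * F x ∂(torMeas d)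
      map_add' := fun g g' => by
        simp only [ContinuousMap.add_apply, add_mul]
        exact integral_add (hint g) (hint g')
      map_smul' := fun c g => by
        simp only [ContinuousMap.smul_apply, smul_eq_mul, mul_assoc, RingHom.id_apply]
        exact integral_const_mul _ _ } (∫ x, ‖F x‖ ∂(torMeas d)) (by
      intro g
      simp only [LinearMap.coe_mk, AddHom.coe_mk]
      refine (norm_integral_le_integral_norm _).trans ?_
      rw [mul_comm, ← integral_const_mul]
      refine integral_mono (hint g).norm (hF.norm.const_mul _) fun x => ?_
      simp only [norm_mul]
      exact mul_le_mul_of_nonneg_right (g.norm_coe_le_norm x) (norm_nonneg _))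
  have hL : ∀ g, L g = 0 := by
    intro g
    have hle : (Submodule.span ℂ (Set.range <| UnitAddTorus.mFourier (d := Fin d))).topologicalClosure
        ≤ LinearMap.ker L.toLinearMap := by
      refine Submodule.topologicalClosure_minimal _ ?_ L.isClosed_ker
      rw [Submodule.span_le]
      rintro _ ⟨n, rfl⟩
      exact h n
    rw [UnitAddTorus.span_mFourier_closure_eq_top] at hle
    exact hle (Submodule.mem_top (x := g))
  refine ae_eq_zero_of_forall_setIntegral_isClosed_eq_zero hF fun s hs => ?_
  let δ : ℕ → ℝ := fun n => 1 / ((n : ℝ) + 1)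
  have hδ : ∀ n, 0 < δ n := fun n => by positivity
  have hδ' : Tendsto δ atTop (𝓝 0) := tendsto_one_div_add_atTop_nhds_zero_nat
  have ht := thickenedIndicator_tendsto_indicator_closure hδ hδ' s
  rw [hs.closure_eq, tendsto_pi_nhds] at ht
  let g : ℕ → C(UnitAddTorus (Fin d), ℂ) := fun n =>
    ⟨fun x => (((thickenedIndicator (hδ n) s x : NNReal) : ℝ) : ℂ), by fun_prop⟩
  have h0 : ∀ n, ∫ x, g n x * F x ∂(torMeas d) = 0 := fun n => hL (g n)
  have hlim : Tendsto (fun n => ∫ x, g n x * F x ∂(torMeas d)) atTop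
      (𝓝 (∫ x, s.indicator F x ∂(torMeas d))) := by
    refine tendsto_integral_of_dominated_convergence (fun x => ‖F x‖)
      (fun n => (hint (g n)).aestronglyMeasurable) hF.norm (fun n => Eventually.of_forall fun x => ?_)
      (Eventually.of_forall fun x => ?_)
    · rw [norm_mul]
      refine mul_le_of_le_one_left (norm_nonneg _) ?_
      have := thickenedIndicator_le_one (hδ n) s x
      simpa [g] using this
    · have h1 : Tendsto (fun n => g n x) atTop (𝓝 (((s.indicator (fun _ => (1 : NNReal)) x : NNReal) : ℝ) : ℂ)) := by
        have hc : Continuous fun r : NNReal => ((r : ℝ) : ℂ) := by fun_prop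
        exact (hc.tendsto _).comp (ht x)
      have := h1.mul_const (F x)
      convert this using 2
      by_cases hx : x ∈ s <;> simp [hx]
  rw [integral_indicator hs.measurableSet] at hlim
  simp only [h0] at hlim
  exact tendsto_nhds_unique hlim tendsto_const_nhds

section Abs
variable {Ω J H E : Type*} [MeasurableSpace Ω] {μ : Measure Ω}
  [NormedAddCommGroup H] [InnerProductSpace ℂ H] [CompleteSpace H]
  [NormedAddCommGroup E] [InnerProductSpace ℂ E] [CompleteSpace E]

theorem L2_norm_sq (f : Lp E 2 μ) : ‖f‖ ^ 2 = ∫ ω, ‖f ω‖ ^ 2 ∂μ := by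
  have h := inner_self_eq_norm_sq_to_K (𝕜 := ℂ) f
  rw [L2.inner_def] at h
  simp only [inner_self_eq_norm_sq_to_K] at h
  have h2 : (∫ ω, ((‖f ω‖ ^ 2 : ℝ) : ℂ) ∂μ) = ((‖f‖ ^ 2 : ℝ) : ℂ) := by
    simp only [Complex.ofReal_pow]
    exact h
  rw [integral_complex_ofReal] at h2
  exact_mod_cast h2.symm

theorem exists_infDist_eq (W : Submodule ℂ H) (hW : IsClosed (W : Set H)) (f : H) :
    ∃ p ∈ W, infDist f (W : Set H) = ‖f - p‖ := by
  obtain ⟨p, hp, h⟩ := Submodule.exists_norm_eq_iInf_of_complete_subspace W hW.isComplete f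
  refine ⟨p, hp, ?_⟩
  rw [h, infDist_eq_iInf]
  simp only [dist_eq_norm]

/-- Span of translates. -/
def gsp {κ : Type*} (T : J → H → H) (φ : κ → H) : Submodule ℂ H :=
  (Submodule.span ℂ {x | ∃ (i : κ) (j : J), x = T j (φ i)}).topologicalClosure

theorem mem_gsp_of_ae {κ : Type*} [Fintype κ] (e : J → Ω → ℂ)
    (huniq : ∀ F : Ω → ℂ, Integrable F μ → (∀ j, ∫ ω, e j ω * F ω ∂μ = 0) → F =ᵐ[μ] 0)
    (T : J → H → H) (Φ : H →ₗᵢ[ℂ] Lp E 2 μ)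
    (hT : ∀ j f, Φ (T j f) =ᵐ[μ] fun ω => e j ω • Φ f ω)
    (φ : κ → H) (h : Lp E 2 μ) (a : κ → Ω → ℂ)
    (hh : h =ᵐ[μ] fun ω => ∑ i, a i ω • Φ (φ i) ω) : ∃ g ∈ gsp T φ, Φ g = h := by
  set M : Submodule ℂ (Lp E 2 μ) := (gsp T φ).map Φ.toLinearMap with hM
  have hcomp : IsComplete (M : Set (Lp E 2 μ)) := by
    have : IsComplete ((gsp T φ : Submodule ℂ H) : Set H) :=
      (Submodule.isClosed_topologicalClosure _).isComplete
    exact (LinearIsometry.isComplete_map_iff (p := gsp T φ) (f := Φ)).2 this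
  have : CompleteSpace M := hcomp.completeSpace_coe
  have hmem : h ∈ M := by
    rw [← Submodule.orthogonal_orthogonal M, Submodule.mem_orthogonal]
    intro g hg
    have h1 : ∀ i, ∀ᵐ ω ∂μ, inner ℂ (g ω) (Φ (φ i) ω) = 0 := by
      intro i
      refine huniq _ (L2.integrable_inner g (Φ (φ i))) fun j => ?_
      have h2 : inner ℂ g (Φ (T j (φ i))) = 0 := by
        refine (Submodule.mem_orthogonal' M g).1 hg _ ⟨T j (φ i), ?_, rfl⟩
        exact Submodule.le_topologicalClosure _ (Submodule.subset_span ⟨i, j, rfl⟩)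
      rw [L2.inner_def] at h2
      rw [← h2]
      refine integral_congr_ae ?_
      filter_upwards [hT j (φ i)] with ω hω
      rw [hω, inner_smul_right]
    rw [L2.inner_def]
    refine integral_eq_zero_of_ae ?_
    filter_upwards [hh, ae_all_iff.2 h1] with ω h2 h3
    rw [h2]
    simp [inner_sum, inner_smul_right, h3]
  obtain ⟨g, hg, hgh⟩ := hmem
  exact ⟨g, hg, hgh⟩

theorem ae_mem_span_of_mem_gsp {κ : Type*} [Finite κ] (e : J → Ω → ℂ)
    (T : J → H → H) (Φ : H →ₗᵢ[ℂ] Lp E 2 μ)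
    (hT : ∀ j f, Φ (T j f) =ᵐ[μ] fun ω => e j ω • Φ f ω)
    (ψ : κ → H) (p : H) (hp : p ∈ gsp T ψ) :
    ∀ᵐ ω ∂μ, Φ p ω ∈ Submodule.span ℂ (Set.range fun i => Φ (ψ i) ω) := by
  let S : Submodule ℂ H :=
    { carrier := {p | ∀ᵐ ω ∂μ, Φ p ω ∈ Submodule.span ℂ (Set.range fun i => Φ (ψ i) ω)}
      zero_mem' := by
        change ∀ᵐ ω ∂μ, _
        rw [map_zero]
        filter_upwards [Lp.coeFn_zero E 2 μ] with ω hω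
        rw [hω]; exact Submodule.zero_mem _
      add_mem' := by
        intro x y hx hy
        change ∀ᵐ ω ∂μ, _
        rw [map_add]
        filter_upwards [Lp.coeFn_add (Φ x) (Φ y), hx, hy] with ω hω h1 h2
        rw [hω]; exact Submodule.add_mem _ h1 h2
      smul_mem' := by
        intro c x hx
        change ∀ᵐ ω ∂μ, _
        rw [map_smul]
        filter_upwards [Lp.coeFn_smul c (Φ x), hx] with ω hω h1
        rw [hω]; exact Submodule.smul_mem _ _ h1 }
  have hS : IsClosed (S : Set H) := by
    refine IsSeqClosed.isClosed fun x p hx hxp => ?_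
    have h1 : Tendsto (fun n => Φ (x n)) atTop (𝓝 (Φ p)) := (Φ.continuous.tendsto p).comp hxp
    obtain ⟨ns, -, hns⟩ := (tendstoInMeasure_of_tendsto_Lp h1).exists_seq_tendsto_ae
    change ∀ᵐ ω ∂μ, _
    have h2 : ∀ᵐ ω ∂μ, ∀ n, Φ (x n) ω ∈ Submodule.span ℂ (Set.range fun i => Φ (ψ i) ω) :=
      ae_all_iff.2 hx
    filter_upwards [hns, h2] with ω h3 h4
    have : FiniteDimensional ℂ (Submodule.span ℂ (Set.range fun i => Φ (ψ i) ω)) :=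
      FiniteDimensional.span_of_finite ℂ (Set.finite_range _)
    exact (Submodule.closed_of_finiteDimensional _).mem_of_tendsto h3
      (Eventually.of_forall fun n => h4 _)
  have hle : gsp T ψ ≤ S := by
    refine Submodule.topologicalClosure_minimal _ ?_ hS
    rw [Submodule.span_le]
    rintro _ ⟨i, j, rfl⟩
    change ∀ᵐ ω ∂μ, _
    filter_upwards [hT j (ψ i)] with ω hω
    rw [hω]
    exact Submodule.smul_mem _ _ (Submodule.subset_span ⟨i, rfl⟩)
  exact hle hp

theorem memLp_sum_smul {κ : Type*} [Fintype κ] (a : κ → Ω → ℂ) (ha : ∀ i, Measurable (a i))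
    (hb : ∀ i ω, ‖a i ω‖ ≤ 1) (g : κ → Lp E 2 μ) :
    MemLp (fun ω => ∑ i, a i ω • g i ω) 2 μ := by
  refine memLp_finsetSum _ fun i _ => ?_
  refine (Lp.memLp (g i)).of_le ((ha i).aestronglyMeasurable.smul (Lp.aestronglyMeasurable _))
    (Eventually.of_forall fun ω => ?_)
  rw [norm_smul]
  exact mul_le_of_le_one_left (norm_nonneg _) (hb i ω)

theorem abs_main {ι : Type*} [Fintype ι] (k : ℕ) (e : J → Ω → ℂ)
    (huniq : ∀ F : Ω → ℂ, Integrable F μ → (∀ j, ∫ ω, e j ω * F ω ∂μ = 0) → F =ᵐ[μ] 0)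
    (T : J → H → H) (Φ : H →ₗᵢ[ℂ] Lp E 2 μ)
    (hT : ∀ j f, Φ (T j f) =ᵐ[μ] fun ω => e j ω • Φ f ω)
    (f : ι → H) : ∃ φ : Fin k → H, ∀ ψ : Fin k → H,
      ∑ i, infDist (f i) (gsp T φ : Set H) ^ 2 ≤ ∑ i, infDist (f i) (gsp T ψ : Set H) ^ 2 := by
  let K := closedBall (0 : Fin k → ι → ℂ) 1
  have : Nonempty K := ⟨⟨0, mem_closedBall_self zero_le_one⟩⟩
  have : CompactSpace K := isCompact_iff_compactSpace.1 (isCompact_closedBall _ _)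
  let h : Ω → K → ℝ := fun ω B =>
    ∑ i, ‖Φ (f i) ω - ∑ l, conj (B.1 l i) • ∑ j, B.1 l j • Φ (f j) ω‖ ^ 2
  obtain ⟨u, hu, humin⟩ := measurable_argmin h (by
    intro B
    refine Finset.measurable_fun_sum _ fun i _ => ?_
    have hs : ∀ i, StronglyMeasurable fun ω => Φ (f i) ω := fun i => Lp.stronglyMeasurable _
    refine (StronglyMeasurable.measurable ?_).pow_const 2
    refine StronglyMeasurable.norm ((hs i).sub ?_)
    refine Finset.stronglyMeasurable_fun_sum _ fun l _ => StronglyMeasurable.const_smul ?_ _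
    exact Finset.stronglyMeasurable_fun_sum _ fun j _ => (hs j).const_smul _) (by
    intro ω
    have : ∀ l i, Continuous fun B : K => B.1 l i := fun l i =>
      (continuous_apply i).comp ((continuous_apply l).comp continuous_subtype_val)
    refine continuous_finsetSum _ fun i _ => ?_
    refine (Continuous.norm (continuous_const.sub ?_)).pow 2
    refine continuous_finsetSum _ fun l _ => ?_
    refine (Complex.continuous_conj.comp (this l i)).smul ?_
    exact continuous_finsetSum _ fun j _ => (this l j).smul continuous_const)
  have hu1 : ∀ l i, Measurable fun ω => (u ω).1 l i := fun l i =>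
    (measurable_pi_apply i).comp ((measurable_pi_apply l).comp (measurable_subtype_coe.comp hu))
  have hu2 : ∀ l i ω, ‖(u ω).1 l i‖ ≤ 1 := by
    intro l i ω
    have := (u ω).2
    rw [mem_closedBall_zero_iff] at this
    exact (norm_le_pi_norm _ i).trans ((norm_le_pi_norm _ l).trans this)
  have hφ : ∀ l, ∃ φ ∈ gsp T f, Φ φ = (memLp_sum_smul (fun i ω => (u ω).1 l i) (hu1 l) (hu2 l)
      (fun i => Φ (f i))).toLp _ := fun l =>
    mem_gsp_of_ae e huniq T Φ hT f _ _ (MemLp.coeFn_toLp _)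
  choose φ hφ1 hφ2 using hφ
  have hφae : ∀ l, Φ (φ l) =ᵐ[μ] fun ω => ∑ i, (u ω).1 l i • Φ (f i) ω := fun l => by
    rw [hφ2]; exact MemLp.coeFn_toLp _
  have hw : ∀ i, ∃ w ∈ gsp T φ, Φ w = (memLp_sum_smul (fun l ω => conj ((u ω).1 l i))
      (fun l => Complex.continuous_conj.measurable.comp (hu1 l i))
      (fun l ω => by simpa using hu2 l i ω) (fun l => Φ (φ l))).toLp _ := fun i =>
    mem_gsp_of_ae e huniq T Φ hT φ _ _ (MemLp.coeFn_toLp _)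
  choose w hw1 hw2 using hw
  have hwae : ∀ i, Φ (w i) =ᵐ[μ] fun ω => ∑ l, conj ((u ω).1 l i) • Φ (φ l) ω := fun i => by
    rw [hw2]; exact MemLp.coeFn_toLp _
  refine ⟨φ, fun ψ => ?_⟩
  choose p hp1 hp2 using fun i => exists_infDist_eq (gsp T ψ)
    (Submodule.isClosed_topologicalClosure _) (f i)
  have hint : ∀ g : Lp E 2 μ, Integrable (fun ω => ‖g ω‖ ^ 2) μ := fun g =>
    (memLp_two_iff_integrable_sq_norm (Lp.aestronglyMeasurable g)).1 (Lp.memLp g)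
  calc ∑ i, infDist (f i) (gsp T φ : Set H) ^ 2 ≤ ∑ i, ‖Φ (f i - w i)‖ ^ 2 := by
        refine Finset.sum_le_sum fun i _ => ?_
        refine pow_le_pow_left₀ infDist_nonneg ?_ 2
        rw [Φ.norm_map, ← dist_eq_norm]
        exact infDist_le_dist_of_mem (hw1 i)
    _ = ∫ ω, ∑ i, ‖Φ (f i - w i) ω‖ ^ 2 ∂μ := by
        rw [integral_finsetSum _ fun i _ => hint _]
        simp only [L2_norm_sq]
    _ ≤ ∫ ω, ∑ i, ‖Φ (f i - p i) ω‖ ^ 2 ∂μ := by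
        refine integral_mono_ae (integrable_finsetSum _ fun i _ => hint _)
          (integrable_finsetSum _ fun i _ => hint _) ?_
        have e1 : ∀ i, Φ (f i - w i) =ᵐ[μ] fun ω => Φ (f i) ω - Φ (w i) ω := fun i => by
          rw [map_sub]; exact Lp.coeFn_sub _ _
        have e2 : ∀ i, Φ (f i - p i) =ᵐ[μ] fun ω => Φ (f i) ω - Φ (p i) ω := fun i => by
          rw [map_sub]; exact Lp.coeFn_sub _ _
        filter_upwards [ae_all_iff.2 e1, ae_all_iff.2 e2, ae_all_iff.2 hφae, ae_all_iff.2 hwae,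
          ae_all_iff.2 fun i => ae_mem_span_of_mem_gsp e T Φ hT ψ (p i) (hp1 i)] with ω h1 h2 h3 h4 h5
        obtain ⟨B, hB, hBle⟩ := rank_approx k (fun i => Φ (f i) ω) (fun i => Φ (p i) ω) _ h5
        simp only [h1, h2, h4, h3]
        exact (humin ω ⟨B, hB⟩).trans hBle
    _ = ∑ i, ‖Φ (f i - p i)‖ ^ 2 := by
        rw [integral_finsetSum _ fun i _ => hint _]
        simp only [L2_norm_sq]
    _ = ∑ i, infDist (f i) (gsp T ψ : Set H) ^ 2 := by
        simp only [hp2, Φ.norm_map]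
end Abs

section Mul
variable {Ω E : Type*} [MeasurableSpace Ω] {μ : Measure Ω}
  [NormedAddCommGroup E] [InnerProductSpace ℂ E] [CompleteSpace E]

theorem memLp_mulU (c : Ω → ℂ) (hc : Measurable c) (h1 : ∀ ω, ‖c ω‖ = 1) (f : Lp E 2 μ) :
    MemLp (fun ω => c ω • f ω) 2 μ :=
  (Lp.memLp f).of_le (hc.aestronglyMeasurable.smul (Lp.aestronglyMeasurable _))
    (Eventually.of_forall fun ω => by rw [norm_smul, h1, one_mul])

/-- Multiplication by a unimodular function. -/
def mulU (c : Ω → ℂ) (hc : Measurable c) (h1 : ∀ ω, ‖c ω‖ = 1) : Lp E 2 μ →ₗᵢ[ℂ] Lp E 2 μ where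
  toFun f := (memLp_mulU c hc h1 f).toLp _
  map_add' f g := by
    rw [← MemLp.toLp_add]
    refine MemLp.toLp_congr _ _ ?_
    filter_upwards [Lp.coeFn_add f g] with ω hω
    rw [hω, Pi.add_apply, Pi.add_apply, smul_add]
  map_smul' r f := by
    rw [RingHom.id_apply, ← MemLp.toLp_const_smul]
    refine MemLp.toLp_congr _ _ ?_
    filter_upwards [Lp.coeFn_smul r f] with ω hω
    rw [hω, Pi.smul_apply, Pi.smul_apply, smul_comm]
  norm_map' f := by
    simp only [LinearMap.coe_mk, AddHom.coe_mk]
    rw [Lp.norm_toLp, Lp.norm_def]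
    congr 1
    refine eLpNorm_congr_norm_ae (Eventually.of_forall fun ω => ?_)
    rw [norm_smul, h1, one_mul]

theorem coeFn_mulU (c : Ω → ℂ) (hc : Measurable c) (h1 : ∀ ω, ‖c ω‖ = 1) (f : Lp E 2 μ) :
    mulU c hc h1 f =ᵐ[μ] fun ω => c ω • f ω :=
  MemLp.coeFn_toLp (memLp_mulU c hc h1 f)
end Mul

section Fib
variable {E : Type*} [NormedAddCommGroup E] [InnerProductSpace ℂ E] [CompleteSpace E]

def constI (d : ℕ) (E : Type*) [NormedAddCommGroup E] [InnerProductSpace ℂ E] [CompleteSpace E] :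
    E →ₗᵢ[ℂ] Lp E 2 (torMeas d) where
  toLinearMap := Lp.constₗ 2 (torMeas d) ℂ
  norm_map' x := by
    have := Lp.norm_const' 2 (torMeas d) x (by simp) (by simp)
    simpa using this

def mulF (j : Fin d → ℤ) : Lp E 2 (torMeas d) →ₗᵢ[ℂ] Lp E 2 (torMeas d) :=
  mulU (fun ω => UnitAddTorus.mFourier j ω) (UnitAddTorus.mFourier j).continuous.measurable
    (norm_mFourier_apply j)

def fibV (j : Fin d → ℤ) : E →ₗᵢ[ℂ] Lp E 2 (torMeas d) := (mulF j).comp (constI d E)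

theorem coeFn_fibV (j : Fin d → ℤ) (a : E) :
    fibV j a =ᵐ[torMeas d] fun ω => UnitAddTorus.mFourier j ω • a := by
  have h1 : fibV j a =ᵐ[torMeas d] fun ω => UnitAddTorus.mFourier j ω • constI d E a ω :=
    coeFn_mulU _ (UnitAddTorus.mFourier j).continuous.measurable (norm_mFourier_apply j) _
  have h2 : constI d E a =ᵐ[torMeas d] fun _ => a := Lp.coeFn_const ..
  filter_upwards [h1, h2] with ω e1 e2
  rw [e1, e2]

theorem mulF_fibV (i j : Fin d → ℤ) (a : E) : mulF i (fibV j a) = fibV (j + i) a := by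
  refine Lp.ext ?_
  have h1 : mulF i (fibV j a) =ᵐ[torMeas d] fun ω => UnitAddTorus.mFourier i ω • fibV j a ω :=
    coeFn_mulU _ _ _ _
  filter_upwards [h1, coeFn_fibV j a, coeFn_fibV (j + i) a] with ω e1 e2 e3
  rw [e1, e2, e3, UnitAddTorus.mFourier_add, smul_smul, mul_comm]

theorem fibV_orth : OrthogonalFamily ℂ (fun _ : Fin d → ℤ => E) (fun j => fibV (d := d) (E := E) j) := by
  intro i j hij a b
  rw [L2.inner_def]
  have : ∫ ω, inner ℂ (fibV i a ω) (fibV j b ω) ∂(torMeas d) =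
      ∫ ω, UnitAddTorus.mFourier (j + -i) ω * inner ℂ a b ∂(torMeas d) := by
    refine integral_congr_ae ?_
    filter_upwards [coeFn_fibV i a, coeFn_fibV j b] with ω e1 e2
    rw [e1, e2, inner_smul_left, inner_smul_right, UnitAddTorus.mFourier_add, UnitAddTorus.mFourier_neg]
    ring
  rw [this, integral_mul_const, integral_mFourier, if_neg, zero_mul]
  rw [← sub_eq_add_neg, sub_eq_zero]; exact fun h => hij h.symm
end Fib

def cell (j : Fin d → ℤ) : Set (Fin d → ℝ) := {x | ∀ i, ⌊x i⌋ = j i}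

theorem measurableSet_cell (j : Fin d → ℤ) : MeasurableSet (cell j) := by
  have : cell j = ⋂ i, {x : Fin d → ℝ | ⌊x i⌋ = j i} := by ext; simp [cell]
  rw [this]
  refine MeasurableSet.iInter fun i => ?_
  exact (Int.measurable_floor.comp (measurable_pi_apply i)) (measurableSet_singleton (j i))

theorem coeFn_translateZ (j : Fin d → ℤ) (f : Lp ℂ 2 (volume : Measure (Fin d → ℝ))) :
    translateZ j f =ᵐ[volume] fun x => f (x - fun i => (j i : ℝ)) :=
  Lp.coeFn_compMeasurePreserving f _

theorem translateZ_translateZ (i j : Fin d → ℤ) (f : Lp ℂ 2 (volume : Measure (Fin d → ℝ))) :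
    translateZ j (translateZ i f) = translateZ (i + j) f := by
  refine Lp.ext ?_
  have h := (measurePreserving_sub_right (volume : Measure (Fin d → ℝ))
    (fun q => (j q : ℝ))).quasiMeasurePreserving.ae_eq_comp (coeFn_translateZ i f)
  filter_upwards [coeFn_translateZ j (translateZ i f), h, coeFn_translateZ (i+j) f] with x h1 h2 h3
  rw [h1, h3]
  simp only [Function.comp_apply] at h2
  rw [h2]
  congr 1
  ext q; simp; ring

abbrev cellE (d : ℕ) := Lp ℂ 2 ((volume : Measure (Fin d → ℝ)).restrict (cell 0))

def transL (j : Fin d → ℤ) :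
    Lp ℂ 2 (volume : Measure (Fin d → ℝ)) →ₗ[ℂ] Lp ℂ 2 (volume : Measure (Fin d → ℝ)) :=
  Lp.compMeasurePreservingₗ ℂ (fun x => x - fun i => (j i : ℝ))
    (measurePreserving_sub_right volume _)

def coefL (j : Fin d → ℤ) : Lp ℂ 2 (volume : Measure (Fin d → ℝ)) →ₗ[ℂ] cellE d :=
  (LpToLpRestrictCLM (Fin d → ℝ) ℂ ℂ volume 2 (cell 0)).toLinearMap.comp (transL (-j))

theorem coefL_translateZ (i j : Fin d → ℤ) (f : Lp ℂ 2 (volume : Measure (Fin d → ℝ))) :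
    coefL j (translateZ i f) = coefL (j - i) f := by
  change LpToLpRestrictCLM (Fin d → ℝ) ℂ ℂ volume 2 (cell 0) (translateZ (-j) (translateZ i f)) =
    LpToLpRestrictCLM (Fin d → ℝ) ℂ ℂ volume 2 (cell 0) (translateZ (-(j - i)) f)
  rw [translateZ_translateZ]
  congr 2; ring

theorem norm_coefL_sq (j : Fin d → ℤ) (f : Lp ℂ 2 (volume : Measure (Fin d → ℝ))) :
    ‖coefL j f‖ ^ 2 = ∫ x in cell j, ‖f x‖ ^ 2 := by
  rw [L2_norm_sq]
  have h1 : coefL j f =ᵐ[volume.restrict (cell 0)] translateZ (-j) f :=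
    LpToLpRestrictCLM_coeFn ℂ (cell 0) (translateZ (-j) f)
  have h2 := ae_restrict_of_ae (s := cell 0) (coeFn_translateZ (-j) f)
  have h3 : ∫ x in cell 0, ‖coefL j f x‖ ^ 2 =
      ∫ x in cell 0, ‖f (x - fun i => ((-j) i : ℝ))‖ ^ 2 := by
    refine integral_congr_ae ?_
    filter_upwards [h1, h2] with x e1 e2
    rw [e1, e2]
  rw [h3]
  have hp : (cell 0 : Set (Fin d → ℝ)) = (fun x => x - fun i => ((-j) i : ℝ)) ⁻¹' cell j := by
    ext x; simp [cell]
  conv_lhs => rw [hp]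
  exact (measurePreserving_sub_right (volume : Measure (Fin d → ℝ))
    (fun i => ((-j) i : ℝ))).setIntegral_preimage_emb
    (MeasurableEquiv.subRight _).measurableEmbedding (fun x => ‖f x‖ ^ 2) (cell j)

theorem hasSum_coefL (f : Lp ℂ 2 (volume : Measure (Fin d → ℝ))) :
    HasSum (fun j : Fin d → ℤ => ‖coefL j f‖ ^ 2) (‖f‖ ^ 2) := by
  simp only [norm_coefL_sq]
  rw [L2_norm_sq]
  have hU : (⋃ j : Fin d → ℤ, cell j) = Set.univ := by
    ext x; simp only [Set.mem_iUnion, Set.mem_univ, iff_true]; exact ⟨fun i => ⌊x i⌋, fun i => rfl⟩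
  have hint : Integrable (fun x => ‖f x‖ ^ 2) volume :=
    (memLp_two_iff_integrable_sq_norm (Lp.aestronglyMeasurable f)).1 (Lp.memLp f)
  have := hasSum_integral_iUnion (μ := volume) (f := fun x => ‖f x‖ ^ 2)
    (s := fun j : Fin d → ℤ => cell j) measurableSet_cell (by
      intro i j hij
      refine Set.disjoint_left.2 fun x hx hy => hij ?_
      ext q; rw [← hx q, hy q]) hint.integrableOn
  rwa [hU, setIntegral_univ] at this

def coefI (d : ℕ) : Lp ℂ 2 (volume : Measure (Fin d → ℝ)) →ₗᵢ[ℂ]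
    lp (fun _ : Fin d → ℤ => cellE d) 2 where
  toFun f := ⟨fun j => coefL j f, memℓp_gen (by simpa using (hasSum_coefL f).summable)⟩
  map_add' f g := by ext j : 2; exact map_add _ _ _
  map_smul' c f := by ext j : 2; exact map_smul _ _ _
  norm_map' f := by
    have h := lp.norm_rpow_eq_tsum (p := 2) (by simp)
      (⟨fun j => coefL j f, memℓp_gen (by simpa using (hasSum_coefL f).summable)⟩ :
        lp (fun _ : Fin d → ℤ => cellE d) 2)
    have h2 := (hasSum_coefL f).tsum_eq
    simp only [ENNReal.toReal_ofNat, Real.rpow_ofNat] at h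
    rw [h2] at h
    exact (sq_eq_sq₀ (norm_nonneg _) (norm_nonneg _)).1 h

def fibI (d : ℕ) : Lp ℂ 2 (volume : Measure (Fin d → ℝ)) →ₗᵢ[ℂ] Lp (cellE d) 2 (torMeas d) :=
  (fibV_orth (d := d) (E := cellE d)).linearIsometry.comp (coefI d)

theorem hasSum_fibI (f : Lp ℂ 2 (volume : Measure (Fin d → ℝ))) :
    HasSum (fun j : Fin d → ℤ => fibV j (coefL j f)) (fibI d f) :=
  (fibV_orth (d := d) (E := cellE d)).hasSum_linearIsometry (coefI d f)

theorem fibI_translateZ (i : Fin d → ℤ) (f : Lp ℂ 2 (volume : Measure (Fin d → ℝ))) :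
    fibI d (translateZ i f) = mulF i (fibI d f) := by
  have h1 := hasSum_fibI (translateZ i f)
  rw [← (Equiv.addRight i).hasSum_iff] at h1
  have h2 := (hasSum_fibI f).mapL (mulF (E := cellE d) i).toContinuousLinearMap
  refine h1.unique ?_
  have h3 : ((fun j : Fin d → ℤ => fibV j (coefL j (translateZ i f))) ∘ ⇑(Equiv.addRight i)) =
      fun j : Fin d → ℤ => (mulF (E := cellE d) i).toContinuousLinearMap (fibV j (coefL j f)) := ?_
  · rw [h3]; exact h2
  ext1 j
  simp only [Function.comp_apply, Equiv.coe_addRight, coefL_translateZ, add_sub_cancel_right]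
  exact (mulF_fibV i j _).symm

theorem coeFn_fibI_translateZ (i : Fin d → ℤ) (f : Lp ℂ 2 (volume : Measure (Fin d → ℝ))) :
    fibI d (translateZ i f) =ᵐ[torMeas d] fun ω => UnitAddTorus.mFourier i ω • fibI d f ω := by
  rw [fibI_translateZ]; exact coeFn_mulU _ _ _ _

end Helpers

/-- The family of shift-invariant subspaces of `L²(ℝ^d)` of length at most
`k` satisfies MSAP: for every finite set `F` of functions there is a shift-invariant space of
length at most `k` minimizing `Σ_{f ∈ F} dist(f, W)²`. -/
theorem msap_shiftInvariant_length_le (d k : ℕ) :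
    ∀ F : Finset (Lp ℂ 2 (volume : Measure (Fin d → ℝ))),
      ∃ W ∈ shiftInvariantLengthLE d k,
        (∑ f ∈ F, infDist f (W : Set (Lp ℂ 2 (volume : Measure (Fin d → ℝ)))) ^ 2) =
          ⨅ U : shiftInvariantLengthLE d k,
            ∑ f ∈ F, infDist f ((U : Submodule ℂ (Lp ℂ 2 (volume : Measure (Fin d → ℝ)))) :
              Set (Lp ℂ 2 (volume : Measure (Fin d → ℝ)))) ^ 2 := by
  intro F
  obtain ⟨φ, hφ⟩ := abs_main (ι := F) k (fun j ω => UnitAddTorus.mFourier j ω) (tor_uniq d)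
    translateZ (fibI d) coeFn_fibI_translateZ (fun f => (f : Lp ℂ 2 (volume : Measure (Fin d → ℝ))))
  have hmem : gsp translateZ φ ∈ shiftInvariantLengthLE d k := ⟨φ, rfl⟩
  refine ⟨gsp translateZ φ, hmem, le_antisymm ?_ ?_⟩
  · have : Nonempty (shiftInvariantLengthLE d k) := ⟨⟨_, hmem⟩⟩
    refine le_ciInf fun U => ?_
    obtain ⟨_, ψ, rfl⟩ := U
    have h := hφ ψ
    rw [Finset.sum_coe_sort F (fun f => infDist f (gsp translateZ φ : Set _) ^ 2),
      Finset.sum_coe_sort F (fun f => infDist f (gsp translateZ ψ : Set _) ^ 2)] at h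
    exact h
  · refine ciInf_le (f := fun U : shiftInvariantLengthLE d k =>
      ∑ f ∈ F, infDist f ((U : Submodule ℂ (Lp ℂ 2 (volume : Measure (Fin d → ℝ)))) :
              Set (Lp ℂ 2 (volume : Measure (Fin d → ℝ)))) ^ 2) ?_ ⟨_, hmem⟩
    refine ⟨0, ?_⟩
    rintro _ ⟨U, rfl⟩
    exact Finset.sum_nonneg fun f _ => sq_nonneg _

end
end

section
/- Let m be a positive integer, let S_m be the shift operator on ℓ²(ℤ) by m (i.e. (S_m x)_n = x_{n−m}), and let k ∈ ℕ. Let 𝒞_k be the family of all closed subspaces W of ℓ²(ℤ) that are invariant under S_{ml} for all l ∈ ℤ and for which there exist x¹,…,x^k ∈ ℓ²(ℤ) with W equal to the closed linear span of {S_{ml} xⁱ : l ∈ ℤ, 1 ≤ i ≤ k}. Then 𝒞_k satisfies MSAP: for every finite set F ⊆ ℓ²(ℤ) there exists W° ∈ 𝒞_k with Σ_{f∈F} dist(f,W°)² = inf_{W∈𝒞_k} Σ_{f∈F} dist(f,W)². -/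
open Metric

noncomputable section

/-- The Hilbert space `ℓ²(ℤ)` of square-summable complex sequences. -/
abbrev l2Z : Type := lp (fun _ : ℤ => ℂ) 2

/-- The family `C_k` of closed subspaces of `ℓ²(ℤ)` invariant under the shifts `S_{ml}`
(`(S_r x)_n = x_{n-r}`) for all `l ∈ ℤ` and generated, as closed `S_{ml}`-invariant subspaces,
by at most `k` sequences. -/
def shiftmInvariantLengthLE (m : ℕ) (k : ℕ) : Set (Submodule ℂ l2Z) :=
  {W | (∀ l : ℤ, ∀ w ∈ W, ∀ y : l2Z, (∀ n : ℤ, y n = w (n - m * l)) → y ∈ W) ∧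
    ∃ x : Fin k → l2Z,
      W = (Submodule.span ℂ
        {y : l2Z | ∃ (l : ℤ) (i : Fin k), ∀ n : ℤ, y n = x i (n - m * l)}).topologicalClosure}


open MeasureTheory AddCircle

/-- Measurable selection of minimisers over a compact metric space. -/
theorem exists_measurable_argmin {A K : Type*} [TopologicalSpace A] [MeasurableSpace A]
    [BorelSpace A] [MetricSpace K] [CompactSpace K] [Nonempty K] [MeasurableSpace K]
    [BorelSpace K] (φ : A → K → ℝ) (hφ : Continuous (fun p : A × K => φ p.1 p.2)) :
    ∃ s : A → K, Measurable s ∧ ∀ a x, φ a (s a) ≤ φ a x := by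
  obtain ⟨σ, hσc, hσs⟩ := exists_nat_bool_continuous_surjective_of_compact K
  let τ : cantorSet → K := fun c => σ (cantorSetHomeomorphNatToBool c)
  have hτc : Continuous τ := by
    exact hσc.comp cantorSetHomeomorphNatToBool.continuous
  have hτs : Function.Surjective τ := hσs.comp cantorSetHomeomorphNatToBool.surjective
  have : CompactSpace cantorSet := isCompact_iff_compactSpace.mp isCompact_cantorSet
  have : Nonempty cantorSet := ⟨(hτs (Classical.arbitrary K)).choose⟩
  let G : A → Set cantorSet := fun a => {c | ∀ c', φ a (τ c) ≤ φ a (τ c')}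
  have hGall : IsClosed {p : A × cantorSet | p.2 ∈ G p.1} := by
    have : {p : A × cantorSet | p.2 ∈ G p.1} =
        ⋂ c', {p : A × cantorSet | φ p.1 (τ p.2) ≤ φ p.1 (τ c')} := by
      ext p; simp [G]
    rw [this]
    refine isClosed_iInter fun c' => isClosed_le ?_ ?_
    · exact hφ.comp (continuous_fst.prodMk (hτc.comp continuous_snd))
    · exact hφ.comp (continuous_fst.prodMk continuous_const)
  have hGclosed : ∀ a, IsClosed (G a) := fun a =>
    hGall.preimage (Continuous.prodMk_right a)
  have hGne : ∀ a, (G a).Nonempty := by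
    intro a
    obtain ⟨c, -, hc⟩ := isCompact_univ.exists_isMinOn (f := fun c => φ a (τ c)) Set.univ_nonempty
      (hφ.comp (continuous_const.prodMk hτc)).continuousOn
    exact ⟨c, fun c' => hc (Set.mem_univ c')⟩
  have hleast : ∀ a, ∃ c, IsLeast (G a) c := fun a =>
    (hGclosed a).isCompact.exists_isLeast (hGne a)
  choose t ht using hleast
  have htm : Measurable t := by
    suffices h : Measurable fun a => (t a : ℝ) from h.subtype_mk
    refine measurable_of_Iic fun c => ?_
    have : (fun a => (t a : ℝ)) ⁻¹' Set.Iic c =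
        Prod.fst '' ({p : A × cantorSet | p.2 ∈ G p.1} ∩ {p | (p.2 : ℝ) ≤ c}) := by
      ext a
      constructor
      · intro h
        exact ⟨(a, t a), ⟨(ht a).1, h⟩, rfl⟩
      · rintro ⟨⟨a', c'⟩, ⟨h1, h2⟩, rfl⟩
        have h3 : (t a' : ℝ) ≤ c' := (ht a').2 h1
        exact h3.trans h2
    rw [this]
    refine (isClosedMap_fst_of_compactSpace _ (hGall.inter ?_)).measurableSet
    exact isClosed_le (continuous_subtype_val.comp continuous_snd) continuous_const
  refine ⟨fun a => τ (t a), hτc.measurable.comp htm, fun a x => ?_⟩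
  obtain ⟨c', rfl⟩ := hτs x
  exact (ht a).1 c'

/-- The fibre space. -/
abbrev Fib (m : ℕ) : Type := EuclideanSpace ℂ (Fin m)

/-- The rank-one sum `∑ ⟨x_i, a⟩ x_i`. -/
def rk {m k : ℕ} (x : Fin k → Fib m) (a : Fib m) : Fib m := ∑ i, inner ℂ (x i) a • x i

/-- The fibre cost. -/
def fcost {m k : ℕ} {ι : Type} [Fintype ι] (a : ι → Fib m) (x : Fin k → Fib m) : ℝ :=
  ∑ f, ‖a f - rk x (a f)‖ ^ 2

theorem exists_fcost_le {m k : ℕ} {ι : Type} [Fintype ι] (a b : ι → Fib m) (y : Fin k → Fib m)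
    (hb : ∀ f, b f ∈ Submodule.span ℂ (Set.range y)) :
    ∃ x : Fin k → Fib m, (∀ i, ‖x i‖ ≤ 1) ∧ fcost a x ≤ ∑ f, ‖a f - b f‖ ^ 2 := by
  set V := Submodule.span ℂ (Set.range y) with hV
  have hd : Module.finrank ℂ V ≤ k := by
    have h := finrank_range_le_card (R := ℂ) y
    rw [Fintype.card_fin] at h
    exact h
  let e := stdOrthonormalBasis ℂ V
  let x : Fin k → Fib m := Function.extend (Fin.castLE hd) (fun i => (e i : Fib m)) 0
  have hinj : Function.Injective (Fin.castLE hd) := Fin.castLE_injective hd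
  have hx1 : ∀ i, x (Fin.castLE hd i) = e i := fun i => hinj.extend_apply _ _ i
  have hx0 : ∀ i, i ∉ Set.range (Fin.castLE hd) → x i = 0 := fun i hi => by
    simp only [x]
    rw [Function.extend_apply' _ _ _ (by rintro ⟨j, hj⟩; exact hi ⟨j, hj⟩)]; rfl
  refine ⟨x, fun i => ?_, ?_⟩
  · by_cases hi : i ∈ Set.range (Fin.castLE hd)
    · obtain ⟨j, rfl⟩ := hi
      rw [hx1]
      have := e.orthonormal.1 j
      exact this.le
    · simp [hx0 i hi]
  · refine Finset.sum_le_sum fun f _ => ?_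
    have hrk : rk x (a f) = V.starProjection (a f) := by
      have h1 := e.sum_repr' (V.orthogonalProjectionOnto (a f))
      have h2 := congrArg (fun v : V => (v : Fib m)) h1
      rw [Submodule.starProjection_apply, ← h2, rk]
      push_cast
      symm
      refine Fintype.sum_of_injective _ hinj _ _ (fun i hi => by simp [hx0 i hi]) fun i => ?_
      rw [hx1]
      simp
    rw [hrk]
    have := V.starProjection_minimal (a f)
    gcongr
    rw [this]
    exact ciInf_le ⟨0, by rintro _ ⟨w, rfl⟩; positivity⟩ (⟨b f, hb f⟩ : V)

/-- measurable -/
theorem continuous_fcost {m k : ℕ} {ι : Type} [Fintype ι] :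
    Continuous (fun p : (ι → Fib m) × (Fin k → Fib m) => fcost p.1 p.2) := by
  unfold fcost rk
  fun_prop

theorem exists_select (m k : ℕ) (ι : Type) [Fintype ι] :
    ∃ s : (ι → Fib m) → Fin k → Fib m, Measurable s ∧ (∀ a i, ‖s a i‖ ≤ 1) ∧
      ∀ (a b : ι → Fib m) (y : Fin k → Fib m), 
        (∀ f, b f ∈ Submodule.span ℂ (Set.range y)) →
        fcost a (s a) ≤ ∑ f, ‖a f - b f‖ ^ 2 := by
  let K : Set (Fin k → Fib m) := Metric.closedBall 0 1
  have : CompactSpace K := isCompact_iff_compactSpace.mp (isCompact_closedBall _ _)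
  have : Nonempty K := ⟨⟨0, by simp [K]⟩⟩
  obtain ⟨s, hs, hmin⟩ := exists_measurable_argmin (A := ι → Fib m) (K := K)
    (fun a x => fcost a x.1)
    (Continuous.comp (g := fun p : (ι → Fib m) × (Fin k → Fib m) => fcost p.1 p.2)
      (f := fun p : (ι → Fib m) × K => (p.1, p.2.1)) continuous_fcost (by fun_prop))
  have hK : ∀ x : Fin k → Fib m, x ∈ K ↔ ∀ i, ‖x i‖ ≤ 1 := fun x => by
    simp [K, pi_norm_le_iff_of_nonneg]
  refine ⟨fun a => (s a).1, measurable_subtype_coe.comp hs, fun a => (hK _).1 (s a).2, ?_⟩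
  intro a b y hb
  obtain ⟨x, hx, hle⟩ := exists_fcost_le a b y hb
  exact (hmin a ⟨x, (hK x).2 hx⟩).trans hle


/-- The circle. -/
abbrev Circ : Type := AddCircle (1 : ℝ)

/-- `L²` of the circle. -/
abbrev L2C : Type := Lp ℂ 2 (haarAddCircle (T := (1 : ℝ)))

theorem l2Z_summable (f : l2Z) : Summable fun n => ‖f n‖ ^ 2 := by
  have h := (lp.memℓp f).summable (by norm_num)
  simpa using h

theorem l2Z_norm_sq (f : l2Z) : ‖f‖ ^ 2 = ∑' n, ‖f n‖ ^ 2 := by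
  have h := lp.norm_rpow_eq_tsum (p := 2) (by norm_num) f
  simpa using h

/-- Build an element of `ℓ²(ℤ)`. -/
def mkl2 (f : ℤ → ℂ) (hf : Summable fun n => ‖f n‖ ^ 2) : l2Z :=
  ⟨f, (memℓp_gen_iff (by norm_num)).2 (by simpa using hf)⟩

theorem mkl2_apply (f : ℤ → ℂ) (hf : Summable fun n => ‖f n‖ ^ 2) (n : ℤ) : mkl2 f hf n = f n := rfl

/-- Composition with an injective map. -/
def compInj (e : ℤ → ℤ) (he : Function.Injective e) : l2Z →ₗ[ℂ] l2Z where
  toFun f := mkl2 (fun n => f (e n)) ((l2Z_summable f).comp_injective he)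
  map_add' f g := by ext n; simp [mkl2_apply]
  map_smul' c f := by ext n; simp [mkl2_apply]

theorem compInj_apply (e : ℤ → ℤ) (he : Function.Injective e) (f : l2Z) (n : ℤ) :
    compInj e he f n = f (e n) := rfl

/-- The shift as a linear isometry. -/
def shiftL (r : ℤ) : l2Z →ₗᵢ[ℂ] l2Z where
  toLinearMap := compInj (fun n => n - r) (sub_left_injective)
  norm_map' f := by
    rw [← sq_eq_sq₀ (norm_nonneg _) (norm_nonneg _), l2Z_norm_sq, l2Z_norm_sq]
    exact (Equiv.subRight r).tsum_eq (fun n => ‖f n‖ ^ 2)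

theorem shiftL_apply (r : ℤ) (f : l2Z) (n : ℤ) : shiftL r f n = f (n - r) := rfl

theorem inj_poly (m : ℕ) [NeZero m] (j : Fin m) :
    Function.Injective (fun l : ℤ => l * m + (j : ℤ)) := by
  intro a b h
  have : (m : ℤ) ≠ 0 := by exact_mod_cast NeZero.ne m
  exact mul_right_cancel₀ this (add_right_cancel h)

/-- The polyphase decomposition followed by Fourier series, as a linear map. -/
def polyLin (m : ℕ) [NeZero m] : l2Z →ₗ[ℂ] PiLp 2 (fun _ : Fin m => L2C) :=
  (WithLp.linearEquiv 2 ℂ (Fin m → L2C)).symm.toLinearMap ∘ₗ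
    LinearMap.pi (fun j => (fourierBasis (T := (1 : ℝ))).repr.symm.toLinearEquiv.toLinearMap ∘ₗ
      compInj _ (inj_poly m j))

theorem polyLin_apply (m : ℕ) [NeZero m] (f : l2Z) (j : Fin m) :
    polyLin m f j = (fourierBasis (T := (1 : ℝ))).repr.symm (compInj _ (inj_poly m j) f) := rfl

theorem tsum_poly (m : ℕ) [NeZero m] (g : ℤ → ℝ) (hg : Summable g) :
    ∑ j : Fin m, ∑' l : ℤ, g (l * m + (j : ℤ)) = ∑' n, g n := by
  rw [← (Int.divModEquiv m).symm.tsum_eq g]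
  have hs : Summable fun p : ℤ × Fin m => g ((Int.divModEquiv m).symm p) :=
    (Int.divModEquiv m).symm.summable_iff.2 hg
  rw [← (Equiv.prodComm (Fin m) ℤ).tsum_eq]
  have hs2 := Summable.tsum_prod ((Equiv.prodComm (Fin m) ℤ).summable_iff.2 hs)
  exact (tsum_fintype _).symm.trans hs2.symm

theorem polyLin_norm (m : ℕ) [NeZero m] (f : l2Z) : ‖polyLin m f‖ = ‖f‖ := by
  rw [← sq_eq_sq₀ (norm_nonneg _) (norm_nonneg _), PiLp.norm_sq_eq_of_L2, l2Z_norm_sq,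
    ← tsum_poly m _ (l2Z_summable f)]
  refine Finset.sum_congr rfl fun j _ => ?_
  rw [polyLin_apply, LinearIsometryEquiv.norm_map, l2Z_norm_sq]
  rfl

theorem polyLin_surj (m : ℕ) [NeZero m] : Function.Surjective (polyLin m) := by
  intro h
  let c : Fin m → l2Z := fun j => (fourierBasis (T := (1 : ℝ))).repr (h j)
  let g : ℤ → ℂ := fun n => c (Int.divModEquiv m n).2 (Int.divModEquiv m n).1
  have hg : Summable fun n => ‖g n‖ ^ 2 := by
    rw [← (Int.divModEquiv m).symm.summable_iff, ← (Equiv.prodComm (Fin m) ℤ).summable_iff]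
    refine (summable_prod_of_nonneg (fun _ => sq_nonneg _)).2 ⟨fun j => ?_, Summable.of_finite⟩
    refine (l2Z_summable (c j)).congr fun l => ?_
    have : g ((Int.divModEquiv m).symm (l, j)) = c j l := by
      simp only [g]
      rw [Equiv.apply_symm_apply]
    exact congrArg (fun z => ‖z‖ ^ 2) this.symm
  refine ⟨mkl2 g hg, ?_⟩
  ext1 j
  rw [polyLin_apply, LinearIsometryEquiv.symm_apply_eq]
  ext l
  rw [compInj_apply, mkl2_apply]
  have : (l * m + (j : ℤ)) = (Int.divModEquiv m).symm (l, j) := rfl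
  simp only [g]
  rw [this, Equiv.apply_symm_apply]

/-- The unitary `ℓ²(ℤ) ≃ L²(𝕋)^m`. -/
def poly (m : ℕ) [NeZero m] : l2Z ≃ₗᵢ[ℂ] PiLp 2 (fun _ : Fin m => L2C) :=
  LinearIsometryEquiv.ofSurjective ⟨polyLin m, polyLin_norm m⟩ (polyLin_surj m)

theorem poly_apply (m : ℕ) [NeZero m] (f : l2Z) (j : Fin m) :
    poly m f j = (fourierBasis (T := (1 : ℝ))).repr.symm (compInj _ (inj_poly m j) f) := rfl

theorem memLp_fourier_mul (l : ℤ) (h : L2C) :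
    MemLp (fun t => fourier l t * h t) 2 (haarAddCircle (T := (1 : ℝ))) := by
  refine (Lp.memLp h).of_le_mul (c := 1) ?_ ?_
  · exact ((fourier l).continuous.aestronglyMeasurable).mul (Lp.aestronglyMeasurable h)
  · filter_upwards with t
    rw [norm_mul, fourier_apply, Circle.norm_coe]

theorem poly_shift (m : ℕ) [NeZero m] (l : ℤ) (x y : l2Z) (h : ∀ n : ℤ, y n = x (n - m * l))
    (j : Fin m) :
    (poly m y j : Circ → ℂ) =ᵐ[haarAddCircle] fun t => fourier l t * poly m x j t := by
  have key : poly m y j = (memLp_fourier_mul l (poly m x j)).toLp := by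
    rw [poly_apply, LinearIsometryEquiv.symm_apply_eq]
    ext q
    rw [fourierBasis_repr, fourierCoeff_congr_ae (MemLp.coeFn_toLp _)]
    have h1 : fourierCoeff (fun t => fourier l t * poly m x j t) q =
        fourierCoeff (poly m x j : Circ → ℂ) (q - l) := by
      unfold fourierCoeff
      refine integral_congr_ae (Filter.Eventually.of_forall fun t => ?_)
      simp only [smul_eq_mul]
      rw [← mul_assoc, ← fourier_add]
      rw [show -(q - l) = -q + l by ring]
    rw [h1, ← fourierBasis_repr, poly_apply, LinearIsometryEquiv.apply_symm_apply, compInj_apply,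
      compInj_apply, h]
    exact congrArg (fun n => x n) (by ring)
  rw [key]
  exact MemLp.coeFn_toLp _


/-- The fibre of `f` at `ω`. -/
def vec (m : ℕ) [NeZero m] (f : l2Z) (ω : Circ) : Fib m := WithLp.toLp 2 (fun j => poly m f j ω)

theorem vec_apply (m : ℕ) [NeZero m] (f : l2Z) (ω : Circ) (j : Fin m) :
    vec m f ω j = poly m f j ω := rfl

theorem measurable_vec (m : ℕ) [NeZero m] (f : l2Z) : Measurable (vec m f) := by
  refine (PiLp.continuous_toLp 2 _).measurable.comp (measurable_pi_lambda _ fun j => ?_)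
  exact (Lp.stronglyMeasurable _).measurable

theorem L2C_norm_sq (h : L2C) : ‖h‖ ^ 2 = ∫ t, ‖h t‖ ^ 2 ∂haarAddCircle := by
  rw [← tsum_sq_fourierCoeff, ← LinearIsometryEquiv.norm_map (fourierBasis (T := (1 : ℝ))).repr h,
    l2Z_norm_sq]
  simp_rw [fourierBasis_repr]

theorem L2C_integrable_sq (h : L2C) : Integrable (fun t => ‖h t‖ ^ 2) haarAddCircle :=
  (Lp.memLp h).integrable_norm_pow (by norm_num)

theorem vec_norm_sq_fun (m : ℕ) [NeZero m] (f : l2Z) :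
    (fun ω => ‖vec m f ω‖ ^ 2) = fun ω => ∑ j, ‖poly m f j ω‖ ^ 2 := by
  funext ω
  rw [EuclideanSpace.norm_sq_eq]
  rfl

theorem vec_integrable_sq (m : ℕ) [NeZero m] (f : l2Z) :
    Integrable (fun ω => ‖vec m f ω‖ ^ 2) haarAddCircle := by
  rw [vec_norm_sq_fun]
  exact integrable_finsetSum _ fun j _ => L2C_integrable_sq _

theorem vec_norm_sq (m : ℕ) [NeZero m] (f : l2Z) :
    ‖f‖ ^ 2 = ∫ ω, ‖vec m f ω‖ ^ 2 ∂haarAddCircle := by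
  rw [vec_norm_sq_fun, integral_finsetSum _ fun j _ => L2C_integrable_sq _,
    ← LinearIsometryEquiv.norm_map (poly m) f, PiLp.norm_sq_eq_of_L2]
  exact Finset.sum_congr rfl fun j _ => L2C_norm_sq _

theorem vec_ext (m : ℕ) [NeZero m] (f : l2Z) (g : Circ → Fib m)
    (h : ∀ j, (poly m f j : Circ → ℂ) =ᵐ[haarAddCircle] fun ω => g ω j) :
    vec m f =ᵐ[haarAddCircle] g := by
  filter_upwards [ae_all_iff.2 h] with ω hω
  ext j
  exact hω j

theorem vec_add (m : ℕ) [NeZero m] (f g : l2Z) :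
    vec m (f + g) =ᵐ[haarAddCircle] fun ω => vec m f ω + vec m g ω := by
  refine vec_ext m _ _ fun j => ?_
  rw [map_add]
  exact Lp.coeFn_add _ _

theorem vec_sub (m : ℕ) [NeZero m] (f g : l2Z) :
    vec m (f - g) =ᵐ[haarAddCircle] fun ω => vec m f ω - vec m g ω := by
  refine vec_ext m _ _ fun j => ?_
  rw [map_sub]
  exact Lp.coeFn_sub _ _

theorem vec_smul (m : ℕ) [NeZero m] (c : ℂ) (f : l2Z) :
    vec m (c • f) =ᵐ[haarAddCircle] fun ω => c • vec m f ω := by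
  refine vec_ext m _ _ fun j => ?_
  rw [map_smul]
  exact Lp.coeFn_smul _ _

theorem vec_zero (m : ℕ) [NeZero m] :
    vec m 0 =ᵐ[haarAddCircle] fun _ => 0 := by
  refine vec_ext m _ _ fun j => ?_
  rw [map_zero]
  exact Lp.coeFn_zero _ _ _

theorem vec_sum (m : ℕ) [NeZero m] {ι : Type} (s : Finset ι) (f : ι → l2Z) :
    vec m (∑ i ∈ s, f i) =ᵐ[haarAddCircle] fun ω => ∑ i ∈ s, vec m (f i) ω := by
  classical
  induction s using Finset.induction_on with
  | empty => simpa using vec_zero m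
  | insert a s ha ih =>
    rw [Finset.sum_insert ha]
    filter_upwards [vec_add m (f a) (∑ i ∈ s, f i), ih] with ω h1 h2
    rw [h1, h2, Finset.sum_insert ha]

theorem vec_shift (m : ℕ) [NeZero m] (l : ℤ) (x y : l2Z) (h : ∀ n : ℤ, y n = x (n - m * l)) :
    vec m y =ᵐ[haarAddCircle] fun ω => (fourier l ω : ℂ) • vec m x ω :=
  vec_ext m _ _ fun j => poly_shift m l x y h j

/-- generating set -/
def genSet (m k : ℕ) (x : Fin k → l2Z) : Set l2Z :=
  {y : l2Z | ∃ (l : ℤ) (i : Fin k), ∀ n : ℤ, y n = x i (n - m * l)}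

theorem vec_mem_span (m k : ℕ) [NeZero m] (y : Fin k → l2Z) (u : l2Z)
    (hu : u ∈ Submodule.span ℂ (genSet m k y)) :
    ∀ᵐ ω ∂haarAddCircle, vec m u ω ∈ Submodule.span ℂ (Set.range fun i => vec m (y i) ω) := by
  induction hu using Submodule.span_induction with
  | mem u h =>
    obtain ⟨l, i, h⟩ := h
    filter_upwards [vec_shift m l _ _ h] with ω hω
    rw [hω]
    exact Submodule.smul_mem _ _ (Submodule.subset_span ⟨i, rfl⟩)
  | zero =>
    filter_upwards [vec_zero m] with ω hω
    rw [hω]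
    exact Submodule.zero_mem _
  | add u v _ _ h1 h2 =>
    filter_upwards [vec_add m u v, h1, h2] with ω hω a b
    rw [hω]
    exact Submodule.add_mem _ a b
  | smul c u _ h1 =>
    filter_upwards [vec_smul m c u, h1] with ω hω a
    rw [hω]
    exact Submodule.smul_mem _ _ a

theorem closure_mem_family (m k : ℕ) (x : Fin k → l2Z) :
    (Submodule.span ℂ (genSet m k x)).topologicalClosure ∈ shiftmInvariantLengthLE m k := by
  refine ⟨fun l w hw y hy => ?_, x, rfl⟩
  have hyw : y = shiftL (m * l) w := by
    ext n
    rw [hy, shiftL_apply]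
  have hle : (Submodule.span ℂ (genSet m k x)) ≤
      (Submodule.span ℂ (genSet m k x)).comap (shiftL (m * l)).toLinearMap := by
    rw [Submodule.span_le]
    rintro u ⟨l', i, hu⟩
    refine Submodule.subset_span ⟨l' + l, i, fun n => ?_⟩
    have : (shiftL (m * l)).toLinearMap u n = u (n - m * l) := rfl
    rw [this, hu]
    exact congrArg (fun n => x i n) (by ring)
  rw [hyw]
  exact map_mem_closure (shiftL (m * l)).continuous hw hle

/-- lower bound -/
theorem lower_bound (m k : ℕ) [NeZero m] (F : Finset l2Z) (s : (F → Fib m) → Fin k → Fib m)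
    (hs : ∀ (a b : F → Fib m) (y : Fin k → Fib m),
        (∀ f, b f ∈ Submodule.span ℂ (Set.range y)) →
        fcost a (s a) ≤ ∑ f, ‖a f - b f‖ ^ 2)
    (U : Submodule ℂ l2Z) (hU : U ∈ shiftmInvariantLengthLE m k) :
    ∫ ω, fcost (fun f : F => vec m f ω) (s fun f : F => vec m f ω) ∂haarAddCircle ≤
      ∑ f : F, infDist (f : l2Z) (U : Set l2Z) ^ 2 := by
  obtain ⟨-, y, hy⟩ := hU
  have key : ∀ u : F → l2Z, (∀ f, u f ∈ Submodule.span ℂ (genSet m k y)) →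
      ∫ ω, fcost (fun f : F => vec m f ω) (s fun f : F => vec m f ω) ∂haarAddCircle ≤
        ∑ f : F, ‖(f : l2Z) - u f‖ ^ 2 := by
    intro u hu
    simp_rw [vec_norm_sq m]
    rw [← integral_finsetSum _ fun j _ => vec_integrable_sq _ _]
    refine integral_mono_of_nonneg (Filter.Eventually.of_forall fun ω => ?_)
      (integrable_finsetSum _ fun j _ => vec_integrable_sq _ _) ?_
    · exact Finset.sum_nonneg fun _ _ => by positivity
    · filter_upwards [ae_all_iff.2 fun f : F => vec_mem_span m k y (u f) (hu f),
        ae_all_iff.2 fun f : F => vec_sub m f (u f)] with ω h1 h2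
      simp only [h2]
      exact hs _ (fun f => vec m (u f) ω) _ h1
  have hδ : ∀ δ : ℝ, 0 < δ →
      ∫ ω, fcost (fun f : F => vec m f ω) (s fun f : F => vec m f ω) ∂haarAddCircle ≤
        ∑ f : F, (infDist (f : l2Z) (U : Set l2Z) + δ) ^ 2 := by
    intro δ hδ
    have hex : ∀ f : F, ∃ u ∈ (Submodule.span ℂ (genSet m k y) : Set l2Z),
        dist (f : l2Z) u < infDist (f : l2Z) (U : Set l2Z) + δ := by
      intro f
      have hUc : (U : Set l2Z) = closure (Submodule.span ℂ (genSet m k y) : Set l2Z) := by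
        rw [hy]; rfl
      rw [hUc, infDist_closure]
      exact (infDist_lt_iff ⟨0, Submodule.zero_mem _⟩).1 (by linarith)
    choose u hu hd using hex
    refine (key u hu).trans (Finset.sum_le_sum fun f _ => ?_)
    rw [← dist_eq_norm]
    have := (hd f).le
    gcongr
  have hcont : Continuous fun δ : ℝ => ∑ f : F, (infDist (f : l2Z) (U : Set l2Z) + δ) ^ 2 := by
    fun_prop
  have hlim := (hcont.tendsto 0).mono_left (nhdsWithin_le_nhds (s := Set.Ioi 0))
  simp only [add_zero] at hlim
  refine ge_of_tendsto hlim ?_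
  filter_upwards [self_mem_nhdsWithin] with δ h
  exact hδ δ h

/-- multiplying a bounded generator by an `L²` function stays in the generated space -/
theorem mul_mem (m k : ℕ) [NeZero m] (g : Fin k → Circ → Fib m) (hg : ∀ i, Measurable (g i))
    (hb : ∀ i ω, ‖g i ω‖ ≤ 1) (x : Fin k → l2Z) (hx : ∀ i, vec m (x i) =ᵐ[haarAddCircle] g i)
    (i : Fin k) (c : L2C) :
    ∃ u ∈ (Submodule.span ℂ (genSet m k x)).topologicalClosure,
      vec m u =ᵐ[haarAddCircle] fun ω => (c ω : ℂ) • g i ω := by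
  have hm : ∀ j, MemLp (fun ω => g i ω j) ⊤ (haarAddCircle (T := (1 : ℝ))) := by
    intro j
    refine memLp_top_of_bound (C := 1) ?_ (Filter.Eventually.of_forall fun ω => ?_)
    · exact (Measurable.aestronglyMeasurable (by have := hg i; fun_prop))
    · exact (PiLp.norm_apply_le (g i ω) j).trans (hb i ω)
  let G : Fin m → Lp ℂ ⊤ (haarAddCircle (T := (1 : ℝ))) := fun j => (hm j).toLp
  let M : Fin m → L2C →L[ℂ] L2C := fun j =>
    ((ContinuousLinearMap.mul ℂ ℂ).holderL haarAddCircle ⊤ 2 2 (G j))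
  have hM : ∀ j c, (M j c : Circ → ℂ) =ᵐ[haarAddCircle] fun ω => c ω * g i ω j := by
    intro j c
    have h1 := ContinuousLinearMap.coeFn_holder (r := 2) (ContinuousLinearMap.mul ℂ ℂ) (G j) c
    filter_upwards [h1, (hm j).coeFn_toLp] with ω h1 h2
    refine h1.trans ?_
    rw [ContinuousLinearMap.mul_apply', h2, mul_comm]
  let Φ : L2C →L[ℂ] l2Z := (poly m).symm.toContinuousLinearEquiv.toContinuousLinearMap ∘L
    (PiLp.continuousLinearEquiv 2 ℂ (fun _ : Fin m => L2C)).symm.toContinuousLinearMap ∘L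
      ContinuousLinearMap.pi M
  have hΦ : ∀ c, poly m (Φ c) = WithLp.toLp 2 (fun j => M j c) := fun c =>
    (poly m).apply_symm_apply _
  have hvΦ : ∀ c, vec m (Φ c) =ᵐ[haarAddCircle] fun ω => (c ω : ℂ) • g i ω := by
    intro c
    refine vec_ext m _ _ fun j => ?_
    rw [hΦ]
    exact hM j c
  refine ⟨Φ c, ?_, hvΦ c⟩
  have hle : Submodule.span ℂ (Set.range (fourierLp (T := (1 : ℝ)) 2)) ≤
      (Submodule.span ℂ (genSet m k x)).comap Φ.toLinearMap := by
    rw [Submodule.span_le]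
    rintro _ ⟨l, rfl⟩
    refine Submodule.subset_span ⟨l, i, ?_⟩
    have heq : Φ (fourierLp 2 l) = shiftL (m * l) (x i) := by
      rw [← sub_eq_zero, ← norm_eq_zero, ← sq_eq_zero_iff, vec_norm_sq m]
      refine integral_eq_zero_of_ae ?_
      filter_upwards [vec_sub m (Φ (fourierLp 2 l)) (shiftL (m * l) (x i)), hvΦ (fourierLp 2 l),
        vec_shift m l (x i) (shiftL (m * l) (x i)) (fun n => rfl), hx i,
        coeFn_fourierLp (T := (1 : ℝ)) 2 l] with ω h1 h2 h3 h4 h5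
      rw [h1, h2, h3, h4, h5]
      simp
    intro n
    have : Φ.toLinearMap (fourierLp 2 l) = shiftL (m * l) (x i) := heq
    rw [this, shiftL_apply]
  have hc : c ∈ closure (Submodule.span ℂ (Set.range (fourierLp (T := (1 : ℝ)) 2)) : Set L2C) := by
    have h := span_fourierLp_closure_eq_top (T := (1 : ℝ)) (p := 2) (by norm_num)
    have h2 : c ∈ (Submodule.span ℂ (Set.range (fourierLp (T := (1 : ℝ)) 2))).topologicalClosure := by
      rw [h]; trivial
    exact h2
  exact map_mem_closure Φ.continuous hc hle

theorem exists_l2Z (m : ℕ) [NeZero m] (g : Circ → Fib m) (hg : Measurable g)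
    (hb : ∀ ω, ‖g ω‖ ≤ 1) : ∃ x : l2Z, vec m x =ᵐ[haarAddCircle] g := by
  have hm : ∀ j, MemLp (fun ω => g ω j) 2 (haarAddCircle (T := (1 : ℝ))) := by
    intro j
    refine MemLp.of_bound (C := 1) ?_ (Filter.Eventually.of_forall fun ω => ?_)
    · exact (Measurable.aestronglyMeasurable (by fun_prop))
    · exact (PiLp.norm_apply_le (g ω) j).trans (hb ω)
  refine ⟨(poly m).symm (WithLp.toLp 2 fun j => (hm j).toLp), vec_ext m _ _ fun j => ?_⟩
  rw [LinearIsometryEquiv.apply_symm_apply]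
  exact (hm j).coeFn_toLp

/-- upper bound -/
theorem upper_bound (m k : ℕ) [NeZero m] (g : Fin k → Circ → Fib m) (hg : ∀ i, Measurable (g i))
    (hb : ∀ i ω, ‖g i ω‖ ≤ 1) (x : Fin k → l2Z) (hx : ∀ i, vec m (x i) =ᵐ[haarAddCircle] g i)
    (f : l2Z) :
    Integrable (fun ω => ‖vec m f ω - rk (fun i => g i ω) (vec m f ω)‖ ^ 2) haarAddCircle ∧
    infDist f ((Submodule.span ℂ (genSet m k x)).topologicalClosure : Set l2Z) ^ 2 ≤
      ∫ ω, ‖vec m f ω - rk (fun i => g i ω) (vec m f ω)‖ ^ 2 ∂haarAddCircle := by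
  have hc : ∀ i, MemLp (fun ω => inner ℂ (g i ω) (vec m f ω)) 2
      (haarAddCircle (T := (1 : ℝ))) := by
    intro i
    have hv : MemLp (vec m f) 2 (haarAddCircle (T := (1 : ℝ))) :=
      (memLp_two_iff_integrable_sq_norm (measurable_vec m f).aestronglyMeasurable).2
        (vec_integrable_sq m f)
    refine hv.of_le_mul (c := 1) ?_ (Filter.Eventually.of_forall fun ω => ?_)
    · exact ((hg i).aestronglyMeasurable).inner hv.1
    · refine (norm_inner_le_norm _ _).trans ?_
      gcongr
      exact hb i ω
  choose u hu hvu using fun i => mul_mem m k g hg hb x hx i (hc i).toLp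
  have hae : (fun ω => ‖vec m (f - ∑ i, u i) ω‖ ^ 2) =ᵐ[haarAddCircle]
      fun ω => ‖vec m f ω - rk (fun i => g i ω) (vec m f ω)‖ ^ 2 := by
    filter_upwards [vec_sub m f (∑ i, u i), vec_sum m Finset.univ u, ae_all_iff.2 hvu,
      ae_all_iff.2 fun i => (hc i).coeFn_toLp] with ω h1 h2 h3 h4
    rw [h1, h2, rk]
    simp only [h3, h4]
  refine ⟨(vec_integrable_sq m _).congr hae, ?_⟩
  rw [← integral_congr_ae hae, ← vec_norm_sq]
  have := infDist_le_dist_of_mem (x := f) (Submodule.sum_mem _ fun i (_ : i ∈ Finset.univ) => hu i)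
  rw [dist_eq_norm] at this
  gcongr
  exact infDist_nonneg

/-- For a positive integer `m` and `k ∈ ℕ`, the family of closed subspaces of
`ℓ²(ℤ)` invariant under the shifts by multiples of `m` and generated by at most `k` sequences
satisfies MSAP. -/
theorem msap_shiftm_invariant (m : ℕ) (hm : 0 < m) (k : ℕ) :
    ∀ F : Finset l2Z, ∃ W ∈ shiftmInvariantLengthLE m k,
      (∑ f ∈ F, infDist f (W : Set l2Z) ^ 2) =
        ⨅ U : shiftmInvariantLengthLE m k,
          ∑ f ∈ F, infDist f ((U : Submodule ℂ l2Z) : Set l2Z) ^ 2 := by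
  intro F
  have : NeZero m := ⟨hm.ne'⟩
  obtain ⟨s, hsm, hsb, hs⟩ := exists_select m k F
  have hmeas : Measurable fun ω : Circ => s fun f : F => vec m f ω :=
    hsm.comp (measurable_pi_lambda _ fun f => measurable_vec m f)
  let g : Fin k → Circ → Fib m := fun i ω => s (fun f : F => vec m f ω) i
  have hg : ∀ i, Measurable (g i) := fun i => (measurable_pi_apply i).comp hmeas
  have hb : ∀ i ω, ‖g i ω‖ ≤ 1 := fun i ω => hsb _ i
  choose x hx using fun i => exists_l2Z m (g i) (hg i) (hb i)
  have hW := closure_mem_family m k x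
  refine ⟨_, hW, ?_⟩
  have : Nonempty (shiftmInvariantLengthLE m k) := ⟨⟨_, hW⟩⟩
  apply le_antisymm
  · refine le_ciInf fun U => ?_
    have h1 := lower_bound m k F s hs U U.2
    rw [← Finset.sum_coe_sort F fun f => infDist f ((U : Submodule ℂ l2Z) : Set l2Z) ^ 2]
    refine le_trans ?_ h1
    change _ ≤ ∫ ω, ∑ f : F, ‖vec m f ω - rk (fun i => g i ω) (vec m f ω)‖ ^ 2 ∂haarAddCircle
    rw [integral_finsetSum Finset.univ fun (f : F) _ => (upper_bound m k g hg hb x hx (f : l2Z)).1,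
      ← Finset.sum_coe_sort F]
    exact Finset.sum_le_sum fun f _ => (upper_bound m k g hg hb x hx (f : l2Z)).2
  · exact ciInf_le (f := fun U : shiftmInvariantLengthLE m k =>
      ∑ f ∈ F, infDist f ((U : Submodule ℂ l2Z) : Set l2Z) ^ 2)
      ⟨0, by rintro _ ⟨U, rfl⟩; exact Finset.sum_nonneg fun _ _ => sq_nonneg _⟩ ⟨_, hW⟩

end
end
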